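/- Fix θ = (σ,δ,α) with σ > 0, δ > 0, α ∈ (0,2). There exist C > 0 and N ∈ ℕ such that for all n ≥ N: | ∫_ℝ (l_α(y, w_n(θ))² / f_α(y, w_n(θ))) dy − κ₀(θ)(κ₁(θ)² + 1/α²) / (n^{1−α/2} (ln n)^{α/2}) | ≤ C (1/(n^{1−α/2} (ln n)^{α/2})) · (ln(ln n))³/(ln n)^{min(1/4, α)}. -/

import Mathlib

open MeasureTheory Filter Set Topology Matrix

noncomputable section

namespace LevyLAN

/-- Standard Gaussian density `φ`. -/
def gauss (y : ℝ) : ℝ := (Real.sqrt (2 * Real.pi))⁻¹ * Real.exp (-(y ^ 2) / 2)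

/-- Symmetric `α`-stable density `φ_α`, defined by Fourier inversion. -/
def stableDensity (α z : ℝ) : ℝ :=
  (2 * Real.pi)⁻¹ * ∫ u : ℝ, Real.cos (z * u) * Real.exp (-(|u| ^ α))

/-- `∂_α φ_α`. -/
def stableDensityDalpha (α z : ℝ) : ℝ :=
  -(2 * Real.pi)⁻¹ * ∫ u : ℝ, Real.cos (z * u) * |u| ^ α * Real.log |u| * Real.exp (-(|u| ^ α))

/-- The operator `(D f) y = (y * f y)' = f y + y * f' y`. -/
def Dop (f : ℝ → ℝ) (y : ℝ) : ℝ := f y + y * deriv f y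

/-- `f_α(y, w)`. -/
def fFun (α y w : ℝ) : ℝ := ∫ z : ℝ, gauss (y - w * z) * stableDensity α z

/-- `g_α(y, w)`. -/
def gFun (α y w : ℝ) : ℝ := ∫ z : ℝ, Dop gauss (y - w * z) * stableDensity α z

/-- `h_α(y, w)`. -/
def hFun (α y w : ℝ) : ℝ := ∫ z : ℝ, gauss (y - w * z) * Dop (stableDensity α) z

/-- `k_α(y, w)`. -/
def kFun (α y w : ℝ) : ℝ := ∫ z : ℝ, gauss (y - w * z) * stableDensityDalpha α z

/-- `c_α`. -/
def cAlpha (α : ℝ) : ℝ :=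
  if α = 1 then 1 / Real.pi
  else -(α * (α - 1)) / (2 * Real.Gamma (2 - α) * Real.cos (Real.pi * α / 2))

/-- `w_n(θ) = n^{1/2 - 1/α} δ / σ`. -/
def wn (n : ℕ) (σ δ α : ℝ) : ℝ := (n : ℝ) ^ ((1 : ℝ) / 2 - 1 / α) * δ / σ

/-- `l_α(y, w)` (it depends on `n`). -/
def lFun (n : ℕ) (α y w : ℝ) : ℝ :=
  ((Real.log n - Real.log (Real.log n)) / (2 * α) - Real.log n / α ^ 2) * hFun α y w
    + kFun α y w

def kappa0 (σ δ α : ℝ) : ℝ := 2 * cAlpha α / (α * (2 - α) ^ (α / 2)) * (δ / σ) ^ α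

def kappa1 (σ δ α : ℝ) : ℝ :=
  Real.log (δ / σ) + deriv cAlpha α / cAlpha α - Real.log (2 - α) / 2 - 1 / α

/-- The density `p_{1/n}(y, θ)`, with parameter `θ = (σ, δ, α) : Fin 3 → ℝ`. -/
def pdens (n : ℕ) (θ : Fin 3 → ℝ) (y : ℝ) : ℝ :=
  Real.sqrt n / θ 0 * fFun (θ 2) (Real.sqrt n * y / θ 0) (wn n (θ 0) (θ 1) (θ 2))

/-- The log-likelihood `ln L_n(θ)`. -/
def logLik (n : ℕ) (θ : Fin 3 → ℝ) (x : Fin n → ℝ) : ℝ :=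
  ∑ i, Real.log (pdens n θ (x i))

/-- Partial derivative in the `j`-th parameter coordinate. -/
def pderiv (j : Fin 3) (F : (Fin 3 → ℝ) → ℝ) (θ : Fin 3 → ℝ) : ℝ :=
  deriv (fun t => F (Function.update θ j t)) (θ j)

/-- The score `G_n(θ) = ∇_θ ln L_n(θ)`. -/
def scoreVec (n : ℕ) (θ : Fin 3 → ℝ) (x : Fin n → ℝ) : Fin 3 → ℝ :=
  fun j => pderiv j (fun θ' => logLik n θ' x) θ

/-- The Hessian matrix `J_n(θ)` of the log-likelihood. -/
def hessMat (n : ℕ) (θ : Fin 3 → ℝ) (x : Fin n → ℝ) : Matrix (Fin 3) (Fin 3) ℝ :=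
  Matrix.of fun i j => pderiv i (fun θ' => pderiv j (fun θ'' => logLik n θ'' x) θ') θ

def rate (n : ℕ) (α : ℝ) : ℝ := Real.log n ^ (α / 4) / (n : ℝ) ^ (α / 4)

/-- The rate matrix `u_n(θ)`. -/
def un (n : ℕ) (θ : Fin 3 → ℝ) : Matrix (Fin 3) (Fin 3) ℝ :=
  !![1 / Real.sqrt n, 0, 0;
     0, rate n (θ 2), -(rate n (θ 2) * (θ 1 / (2 * θ 2)) * (Real.log n - Real.log (Real.log n)));
     0, 0, rate n (θ 2)]

/-- The information matrix `I(θ)`. -/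
def Imat (θ : Fin 3 → ℝ) : Matrix (Fin 3) (Fin 3) ℝ :=
  !![2 / θ 0 ^ 2, 0, 0;
     0, θ 2 ^ 2 / θ 1 ^ 2 * kappa0 (θ 0) (θ 1) (θ 2),
        θ 2 / θ 1 * kappa0 (θ 0) (θ 1) (θ 2) * kappa1 (θ 0) (θ 1) (θ 2);
     0, θ 2 / θ 1 * kappa0 (θ 0) (θ 1) (θ 2) * kappa1 (θ 0) (θ 1) (θ 2),
        kappa0 (θ 0) (θ 1) (θ 2) * (kappa1 (θ 0) (θ 1) (θ 2) ^ 2 + 1 / θ 2 ^ 2)]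

/-- `ℙ_n`, the `n`-fold product of the law with Lebesgue density `p_{1/n}(·, θ)`. -/
def Pn (n : ℕ) (θ : Fin 3 → ℝ) : Measure (Fin n → ℝ) :=
  Measure.pi fun _ => MeasureTheory.volume.withDensity fun y => ENNReal.ofReal (pdens n θ y)

/-- The standard Gaussian measure on `ℝ³`. -/
def stdGauss3 : Measure (Fin 3 → ℝ) :=
  Measure.pi fun _ => ProbabilityTheory.gaussianReal 0 1

/-- Euclidean (Frobenius) norm of a real 3×3 matrix. -/
def frobNorm (M : Matrix (Fin 3) (Fin 3) ℝ) : ℝ := Real.sqrt (∑ i, ∑ j, M i j ^ 2)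

/-- Euclidean norm of a vector of `ℝ³`. -/
def vecNorm (v : Fin 3 → ℝ) : ℝ := Real.sqrt (∑ j, v j ^ 2)

/-- The admissible families of functions `ψ_α^{(p)}`. -/
structure IsPsiFamily (ψ : ℝ → ℕ → ℝ → ℝ) : Prop where
  contDiff : ∀ α ∈ Set.Ioo (0 : ℝ) 2, ∀ p : ℕ, ContDiff ℝ 2 (ψ α p)
  pos : ∀ α ∈ Set.Ioo (0 : ℝ) 2, ∀ p : ℕ, ∀ y : ℝ, 0 < ψ α p y
  even : ∀ α ∈ Set.Ioo (0 : ℝ) 2, ∀ p : ℕ, ∀ y : ℝ, ψ α p (-y) = ψ α p y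
  eq_one : ∀ α ∈ Set.Ioo (0 : ℝ) 2, ∀ p : ℕ, ∀ y : ℝ, |y| ≤ 1 → ψ α p y = 1
  eq_tail : ∀ α ∈ Set.Ioo (0 : ℝ) 2, ∀ p : ℕ, ∀ y : ℝ, 3 ≤ |y| →
    ψ α p y = Real.log |y| ^ p / |y| ^ (α + 1)
  unifBound : ∀ K : Set ℝ, K ⊆ Set.Ioo (0 : ℝ) 2 → IsCompact K → ∀ p : ℕ,
    ∃ c > (0 : ℝ), ∃ C : ℝ, ∀ α ∈ K, ∀ y : ℝ, 1 ≤ |y| → |y| ≤ 3 →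
      c ≤ ψ α p y ∧ ψ α p y ≤ C

/-- `𝓘_α^{(k,l)}`. -/
def Ical (ψ : ℝ → ℕ → ℝ → ℝ) (α : ℝ) (k l : ℕ) (y : ℝ) : ℝ :=
  ∫ z in {z : ℝ | 1 < |z|}, Dop^[k] gauss (y - z) * ψ α l z

/-- `f_α^{(k,l,m)}`. -/
def fklm (α : ℝ) (k l m : ℕ) (y w : ℝ) : ℝ :=
  ∫ z : ℝ, Dop^[k] gauss (y - w * z)
    * Dop^[l] (fun z' => iteratedDeriv m (fun a => stableDensity a z') α) z

def Gamman (n : ℕ) (α : ℝ) : ℝ := Real.sqrt ((1 - α / 2) * Real.log n)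

def Mn (n : ℕ) (α : ℝ) : ℝ := Real.sqrt ((2 - α) * Real.log n)

def Kconst (σ δ α : ℝ) : ℝ := deriv cAlpha α + cAlpha α * Real.log (δ / σ)

section

open Complex in
lemma gauss_cos (u y : ℝ) :
    ∫ x : ℝ, gauss x * Real.cos (u * (y - x)) = Real.cos (u * y) * Real.exp (-(u ^ 2) / 2) := by
  have h := fourierIntegral_gaussian (b := (1/2 : ℂ)) (by norm_num) ((-u : ℝ) : ℂ)
  have hintg : Integrable (fun x : ℝ => cexp (I * ((-u : ℝ) : ℂ) * x) * cexp (-(1/2 : ℂ) * x ^ 2)) := by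
    have := integrable_cexp_quadratic (b := (1/2 : ℂ)) (by norm_num) (I * ((-u : ℝ) : ℂ)) 0
    refine this.congr (Eventually.of_forall fun x => ?_)
    simp only [add_zero]
    rw [← Complex.exp_add, add_comm]
  have h2 : ∀ x : ℝ, gauss x * Real.cos (u * (y - x)) =
      (((Real.sqrt (2 * Real.pi))⁻¹ : ℝ) * cexp (I * (u * y)) *
        (cexp (I * ((-u : ℝ) : ℂ) * x) * cexp (-(1/2 : ℂ) * x ^ 2))).re := by
    intro x
    have e1 : cexp (-(1/2 : ℂ) * x ^ 2) = ((Real.exp (-(x^2)/2) : ℝ) : ℂ) := by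
      push_cast; congr 1; ring
    have e2 : cexp (I * (u * y)) * cexp (I * ((-u : ℝ) : ℂ) * x) = cexp (((u * (y - x) : ℝ) : ℂ) * I) := by
      rw [← Complex.exp_add]; congr 1; push_cast; ring
    rw [e1]
    rw [show (((Real.sqrt (2 * Real.pi))⁻¹ : ℝ) : ℂ) * cexp (I * (u * y)) *
        (cexp (I * ((-u : ℝ) : ℂ) * x) * ((Real.exp (-(x^2)/2) : ℝ) : ℂ)) =
        (((Real.sqrt (2 * Real.pi))⁻¹ * Real.exp (-(x^2)/2) : ℝ) : ℂ) * (cexp (I * (u * y)) * cexp (I * ((-u : ℝ) : ℂ) * x)) by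
        push_cast; ring, e2, Complex.re_ofReal_mul, Complex.exp_ofReal_mul_I_re]
    rfl
  simp_rw [h2]
  have := integral_re (𝕜 := ℂ) (hintg.const_mul ((((Real.sqrt (2 * Real.pi))⁻¹ : ℝ) : ℂ) * cexp (I * (u * y))))
  simp only [RCLike.re_to_complex] at this
  rw [this, integral_const_mul, h]
  have e3 : ((Real.pi : ℂ) / (1/2 : ℂ)) ^ (1/2 : ℂ) = ((Real.sqrt (2 * Real.pi) : ℝ) : ℂ) := by
    rw [Real.sqrt_eq_rpow, Complex.ofReal_cpow (by positivity)]
    push_cast; congr 1; ring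
  have e4 : cexp (-((-u : ℝ) : ℂ) ^ 2 / (4 * (1/2 : ℂ))) = ((Real.exp (-(u^2)/2) : ℝ) : ℂ) := by
    push_cast; congr 1; ring
  rw [e3, e4]
  have hs : Real.sqrt (2 * Real.pi) ≠ 0 := by positivity
  rw [show (((Real.sqrt (2 * Real.pi))⁻¹ : ℝ) : ℂ) * cexp (I * (u * y)) *
      (((Real.sqrt (2 * Real.pi) : ℝ) : ℂ) * ((Real.exp (-(u^2)/2) : ℝ) : ℂ)) =
      (((Real.sqrt (2 * Real.pi))⁻¹ * Real.sqrt (2 * Real.pi) * Real.exp (-(u^2)/2) : ℝ) : ℂ) *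
        cexp (((u * y : ℝ) : ℂ) * I) by push_cast; ring_nf, Complex.re_ofReal_mul, Complex.exp_ofReal_mul_I_re,
        inv_mul_cancel₀ hs]
  ring

lemma gauss_integrable : Integrable gauss := by
  unfold gauss
  have := (integrable_exp_neg_mul_sq (b := 1/2) (by norm_num)).const_mul (Real.sqrt (2 * Real.pi))⁻¹
  refine this.congr (Eventually.of_forall fun x => ?_)
  simp only; congr 2; ring

lemma gauss_continuous : Continuous gauss := by unfold gauss; fun_prop
lemma gauss_pos (x : ℝ) : 0 < gauss x := by unfold gauss; positivity

lemma conv_formula (m : ℝ → ℝ) (hm : Integrable m) (w y : ℝ) (hw : 0 < w) :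
    ∫ z : ℝ, gauss (y - w * z) * ((2 * Real.pi)⁻¹ * ∫ u : ℝ, Real.cos (z * u) * m u) =
      (2 * Real.pi)⁻¹ * ∫ v : ℝ, Real.cos (v * y) * Real.exp (-(v ^ 2) / 2) * m (w * v) := by
  have hg : Integrable (fun z : ℝ => gauss (y - w * z)) := by
    have := (gauss_integrable.comp_sub_left y).comp_mul_left' hw.ne'
    exact this
  have hprod : Integrable (Function.uncurry fun z u : ℝ => gauss (y - w * z) * (Real.cos (z * u) * m u)) := by
    have h1 := hg.mul_prod hm
    have h2 := h1.bdd_mul (f := fun p : ℝ × ℝ => Real.cos (p.1 * p.2)) (c := 1)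
      (by apply Continuous.aestronglyMeasurable; fun_prop)
      (Eventually.of_forall fun p => by simpa using Real.abs_cos_le_one _)
    refine h2.congr (Eventually.of_forall fun p => ?_)
    simp only [Function.uncurry]; ring
  calc _ = (2 * Real.pi)⁻¹ * ∫ z : ℝ, ∫ u : ℝ, gauss (y - w * z) * (Real.cos (z * u) * m u) := by
        rw [← integral_const_mul]
        congr 1; ext z; rw [integral_const_mul]; ring
    _ = (2 * Real.pi)⁻¹ * ∫ u : ℝ, ∫ z : ℝ, gauss (y - w * z) * (Real.cos (z * u) * m u) := by
        rw [integral_integral_swap hprod]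
    _ = (2 * Real.pi)⁻¹ * ∫ u : ℝ, w⁻¹ * (Real.cos ((w⁻¹ * u) * y) * Real.exp (-((w⁻¹ * u) ^ 2) / 2) * m (w * (w⁻¹ * u))) := by
        congr 2; ext u
        have : ∀ z : ℝ, gauss (y - w * z) * (Real.cos (z * u) * m u) =
            (fun x => gauss x * Real.cos ((w⁻¹ * u) * (y - x)) * m u) (y - w * z) := by
          intro z
          simp only
          rw [show w⁻¹ * u * (y - (y - w * z)) = z * u by field_simp; ring]; ring
        simp_rw [this]
        rw [Measure.integral_comp_mul_left (fun t => (fun x => gauss x * Real.cos ((w⁻¹ * u) * (y - x)) * m u) (y - t)) w,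
          integral_sub_left_eq_self (fun x => gauss x * Real.cos ((w⁻¹ * u) * (y - x)) * m u)]
        rw [integral_mul_const, gauss_cos, abs_of_pos (by positivity), smul_eq_mul]
        rw [mul_inv_cancel_left₀ hw.ne']
    _ = _ := by
        rw [integral_const_mul, Measure.integral_comp_mul_left (fun v => Real.cos (v * y) * Real.exp (-(v ^ 2) / 2) * m (w * v)),
          abs_of_pos (by positivity), smul_eq_mul, inv_inv, inv_mul_cancel_left₀ hw.ne']

end

section

open Complex in
/-- shifting a contour in a strip -/
lemma strip_shift (H : ℂ → ℂ) (hH : Differentiable ℂ H) (G : ℝ → ℝ) (a b : ℝ) (hab : a ≤ b)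
    (hG : Integrable G) (hbd : ∀ s θ : ℝ, a ≤ θ → θ ≤ b → ‖H (s + θ * I)‖ ≤ G s)
    (h1 : Tendsto G atTop (𝓝 0)) (h2 : Tendsto G atBot (𝓝 0)) :
    ∫ s : ℝ, H (s + a * I) = ∫ s : ℝ, H (s + b * I) := by
  have hc : Continuous H := hH.continuous
  have hintg : ∀ θ : ℝ, a ≤ θ → θ ≤ b → Integrable (fun s : ℝ => H (s + θ * I)) := by
    intro θ h1 h2
    refine hG.mono' (by apply Continuous.aestronglyMeasurable; fun_prop) (Eventually.of_forall fun s => hbd s θ h1 h2)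
  have hA := intervalIntegral_tendsto_integral (hintg a le_rfl hab) tendsto_neg_atTop_atBot tendsto_id
  have hB := intervalIntegral_tendsto_integral (hintg b hab le_rfl) tendsto_neg_atTop_atBot tendsto_id
  have C : ∀ T : ℝ, (∫ s : ℝ in -T..T, H (s + a * I)) - (∫ s : ℝ in -T..T, H (s + b * I)) =
      I * (∫ θ : ℝ in a..b, H ((-T : ℝ) + θ * I)) - I * (∫ θ : ℝ in a..b, H (T + θ * I)) := by
    intro T
    have := integral_boundary_rect_eq_zero_of_differentiableOn H (-T + a * I) (T + b * I) hH.differentiableOn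
    simp only [neg_im, ofReal_im, neg_zero, add_zero, neg_re,
      ofReal_re, add_re, mul_re, I_re, mul_zero, I_im, tsub_zero, add_im, mul_im,
      mul_one, zero_add, smul_eq_mul] at this
    linear_combination this
  have V : ∀ T : ℝ, ‖∫ θ : ℝ in a..b, H (T + θ * I)‖ ≤ G T * |b - a| := by
    intro T
    apply intervalIntegral.norm_integral_le_of_norm_le_const
    intro θ hθ
    rw [uIoc_of_le hab] at hθ
    exact hbd T θ hθ.1.le hθ.2
  have t1 : Tendsto (fun T : ℝ => ∫ θ : ℝ in a..b, H (T + θ * I)) atTop (𝓝 0) :=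
    squeeze_zero_norm V (by simpa using h1.mul_const (|b - a|))
  have t2 : Tendsto (fun T : ℝ => ∫ θ : ℝ in a..b, H ((-T : ℝ) + θ * I)) atTop (𝓝 0) :=
    squeeze_zero_norm (fun T => V (-T)) (by simpa using (h2.comp tendsto_neg_atTop_atBot).mul_const (|b - a|))
  have t3 := (t2.const_mul I).sub (t1.const_mul I)
  have t4 := hA.sub hB
  simp only [id] at t4
  simp_rw [C] at t4
  have := tendsto_nhds_unique t4 t3
  simp only [mul_zero, sub_zero] at this
  exact sub_eq_zero.mp this

lemma exp_image : Real.exp '' univ = Ioi (0:ℝ) := by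
  rw [image_univ, Real.range_exp]

lemma int_exp {E : Type*} [NormedAddCommGroup E] [NormedSpace ℝ E] (g : ℝ → E) :
    ∫ t in Ioi (0:ℝ), g t = ∫ s : ℝ, Real.exp s • g (Real.exp s) := by
  rw [← exp_image, integral_image_eq_integral_abs_deriv_smul MeasurableSet.univ
    (fun x _ => (Real.hasDerivAt_exp x).hasDerivWithinAt) Real.exp_injective.injOn]
  simp

lemma integrable_exp {E : Type*} [NormedAddCommGroup E] [NormedSpace ℝ E] (g : ℝ → E) :
    IntegrableOn g (Ioi (0:ℝ)) ↔ Integrable (fun s : ℝ => Real.exp s • g (Real.exp s)) := by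
  rw [← exp_image, integrableOn_image_iff_integrableOn_abs_deriv_smul MeasurableSet.univ
    (fun x _ => (Real.hasDerivAt_exp x).hasDerivWithinAt) Real.exp_injective.injOn]
  simp

lemma integrableOn_rpow_exp {a c : ℝ} (ha : -1 < a) (hc : 0 < c) :
    IntegrableOn (fun t : ℝ => t ^ a * Real.exp (-(c * t))) (Ioi 0) := by
  have := integrableOn_rpow_mul_exp_neg_mul_rpow (p := 1) (s := a) (b := c) ha one_pos hc
  simpa using this

lemma integrableOn_G (K c : ℝ) (hc : 0 < c) :
    IntegrableOn (fun t : ℝ => K * (1 + t ^ 4) * Real.exp (-(c * t))) (Ioi 0) := by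
  have h0 := integrableOn_rpow_exp (a := 0) (by norm_num) hc
  have h4 := integrableOn_rpow_exp (a := 4) (by norm_num) hc
  refine ((h0.add h4).const_mul K).congr (Eventually.of_forall fun t => ?_)
  have : t ^ (4:ℝ) = t ^ (4:ℕ) := by exact_mod_cast Real.rpow_natCast t 4
  simp only [Pi.add_apply, Real.rpow_zero, this]; ring

open Complex in
lemma ray_integrable (g : ℂ → ℂ) (hg : Differentiable ℂ g) (K c θ : ℝ) (hc : 0 < c)
    (hbd : ∀ s : ℝ,
      ‖g (s + θ * I)‖ ≤ K * (1 + Real.exp s ^ 4) * Real.exp (-(c * Real.exp s))) :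
    IntegrableOn (fun t : ℝ => g (Real.log t + θ * I)) (Ioi 0) := by
  have hc' : Continuous g := hg.continuous
  rw [integrable_exp]
  have := (integrable_exp _).1 (integrableOn_G K c hc)
  refine this.mono' ?_ (Eventually.of_forall fun s => ?_)
  · simp only [Real.log_exp]
    apply Continuous.aestronglyMeasurable; fun_prop
  · rw [norm_smul, Real.log_exp, Real.norm_eq_abs, Real.abs_exp, smul_eq_mul]
    exact mul_le_mul_of_nonneg_left (hbd s) (Real.exp_pos s).le

open Complex in
lemma ray_rotate (g : ℂ → ℂ) (hg : Differentiable ℂ g) (K c a b : ℝ) (hc : 0 < c) (hab : a ≤ b)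
    (hbd : ∀ s θ : ℝ, a ≤ θ → θ ≤ b →
      ‖g (s + θ * I)‖ ≤ K * (1 + Real.exp s ^ 4) * Real.exp (-(c * Real.exp s))) :
    ∫ t in Ioi (0:ℝ), cexp (a * I) * g (Real.log t + a * I) =
    ∫ t in Ioi (0:ℝ), cexp (b * I) * g (Real.log t + b * I) := by
  rw [int_exp, int_exp]
  have key : ∀ θ : ℝ, (∫ s : ℝ, Real.exp s • (cexp (θ * I) * g (Real.log (Real.exp s) + θ * I))) =
      ∫ s : ℝ, (fun ζ : ℂ => cexp ζ * g ζ) (s + θ * I) := by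
    intro θ; congr 1; ext s
    simp only [Real.log_exp, Complex.exp_add, real_smul, ofReal_exp]; ring
  rw [key, key]
  have t4 : Tendsto (fun t : ℝ => t * (K * (1 + t ^ 4) * Real.exp (-(c * t)))) atTop (𝓝 0) := by
    have p1 := tendsto_rpow_mul_exp_neg_mul_atTop_nhds_zero 1 c hc
    have p5 := tendsto_rpow_mul_exp_neg_mul_atTop_nhds_zero 5 c hc
    have := (p1.add p5).const_mul K
    simp only [add_zero, mul_zero] at this
    refine this.congr fun t => ?_
    have : t ^ (5:ℝ) = t ^ (5:ℕ) := by exact_mod_cast Real.rpow_natCast t 5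
    rw [this, Real.rpow_one, neg_mul]; ring
  refine strip_shift (fun ζ : ℂ => cexp ζ * g ζ) (by fun_prop) (fun s => Real.exp s * (K * (1 + Real.exp s ^ 4) * Real.exp (-(c * Real.exp s))))
    a b hab ?_ ?_ ?_ ?_
  · simpa using (integrable_exp _).1 (integrableOn_G K c hc)
  · intro s θ h1 h2
    rw [norm_mul, Complex.norm_exp]
    simp only [add_re, ofReal_re, mul_re, I_re, mul_zero, ofReal_im, I_im, mul_one, sub_self, add_zero]
    exact mul_le_mul_of_nonneg_left (hbd s θ h1 h2) (Real.exp_pos s).le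
  · exact t4.comp Real.tendsto_exp_atTop
  · have : Continuous (fun t : ℝ => t * (K * (1 + t ^ 4) * Real.exp (-(c * t)))) := by fun_prop
    have h0 := this.tendsto 0
    simp only [zero_mul] at h0
    exact h0.comp (Real.tendsto_exp_atBot)

end

section

lemma integrable_abs (m : ℝ → ℝ) (hm : IntegrableOn m (Ioi 0)) : Integrable (fun u : ℝ => m |u|) := by
  have h1 : IntegrableOn (fun x => m |x|) (Ioi 0) := by
    refine hm.congr_fun (fun x hx => ?_) measurableSet_Ioi
    rw [abs_of_pos hx]
  have int_Iic : IntegrableOn (fun x ↦ m |x|) (Iic 0) := by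
    rw [← Measure.map_neg_eq_self (volume : Measure ℝ)]
    let e : MeasurableEmbedding fun x : ℝ => -x := (Homeomorph.neg ℝ).measurableEmbedding
    rw [e.integrableOn_map_iff]
    simp_rw [Function.comp_def, abs_neg, neg_preimage, neg_Iic, neg_zero]
    exact Iff.mpr integrableOn_Ici_iff_integrableOn_Ioi h1
  rw [← integrableOn_univ, ← Iic_union_Ioi (a := (0:ℝ))]
  exact int_Iic.union h1

lemma cos_abs_mul (v y : ℝ) : Real.cos (|v| * y) = Real.cos (v * y) := by
  rcases abs_cases v with h | h <;> rw [h.1]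
  rw [neg_mul, Real.cos_neg]

lemma conv_half (m : ℝ → ℝ) (hm : IntegrableOn m (Ioi 0)) (w y : ℝ) (hw : 0 < w) :
    ∫ z : ℝ, gauss (y - w * z) * ((2 * Real.pi)⁻¹ * ∫ u : ℝ, Real.cos (z * u) * m |u|) =
      Real.pi⁻¹ * ∫ t in Ioi (0:ℝ), Real.cos (t * y) * Real.exp (-(t ^ 2) / 2) * m (w * t) := by
  rw [conv_formula (fun u => m |u|) (integrable_abs m hm) w y hw]
  have := integral_comp_abs (f := fun t => Real.cos (t * y) * Real.exp (-(t ^ 2) / 2) * m (w * t))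
  simp only [cos_abs_mul, sq_abs] at this
  simp only [abs_mul, abs_of_pos hw]
  rw [this, mul_inv]; ring

lemma int_m (α p c : ℝ) (hα : 0 < α) (hc : 0 < c) (hp : -1 < p) :
    IntegrableOn (fun t : ℝ => t ^ p * Real.exp (-(c * t ^ α))) (Ioi 0) := by
  have := integrableOn_rpow_mul_exp_neg_mul_rpow (p := α) (s := p) (b := c) hp hα hc
  simpa using this

lemma abs_log_le (t ε : ℝ) (ht : 0 < t) (hε : 0 < ε) : |Real.log t| ≤ (t ^ ε + t ^ (-ε)) / ε := by
  have h1 := Real.log_le_rpow_div ht.le hε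
  have h2 := Real.log_le_rpow_div (inv_pos.2 ht).le hε
  rw [Real.log_inv, Real.inv_rpow ht.le, ← Real.rpow_neg ht.le] at h2
  have p1 := Real.rpow_pos_of_pos ht ε
  have p2 := Real.rpow_pos_of_pos ht (-ε)
  have e1 : 0 < t ^ ε / ε := by positivity
  have e2 : 0 < t ^ (-ε) / ε := by positivity
  rw [add_div, abs_le]; constructor <;> linarith

lemma int_mlog (α : ℝ) (hα : 0 < α) :
    IntegrableOn (fun t : ℝ => t ^ α * Real.log t * Real.exp (-(t ^ α))) (Ioi 0) := by
  have h1 := int_m α (2 * α) 1 hα one_pos (by linarith)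
  have h2 := int_m α 0 1 hα one_pos (by norm_num)
  refine ((h1.add h2).const_mul (1 / α)).mono' (by
    apply Measurable.aestronglyMeasurable; fun_prop) ?_
  refine (ae_restrict_iff' measurableSet_Ioi).2 (Eventually.of_forall fun t (ht : 0 < t) => ?_)
  have := abs_log_le t α ht hα
  rw [norm_mul, norm_mul, Real.norm_eq_abs, Real.norm_eq_abs, Real.norm_eq_abs, Real.abs_exp,
    abs_of_pos (Real.rpow_pos_of_pos ht α)]
  simp only [Pi.add_apply, one_mul, Real.rpow_zero]
  have e : t ^ α * t ^ (-α) = 1 := by rw [← Real.rpow_add ht]; simp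
  have e2 : t ^ (2 * α) = t ^ α * t ^ α := by rw [← Real.rpow_add ht]; ring_nf
  calc t ^ α * |Real.log t| * Real.exp (-t ^ α) ≤ t ^ α * ((t ^ α + t ^ (-α)) / α) * Real.exp (-t ^ α) := by
        gcongr
    _ = (t ^ α * t ^ α + t ^ α * t ^ (-α)) / α * Real.exp (-t ^ α) := by ring
    _ = _ := by rw [e, ← e2]; ring

lemma Q_deriv (α z : ℝ) (hα : 0 < α) :
    HasDerivAt (fun r : ℝ => ∫ u : ℝ, Real.cos (z * u) * Real.exp (-(r * |u| ^ α)))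
      (∫ u : ℝ, Real.cos (z * u) * (-(|u| ^ α) * Real.exp (-(|u| ^ α)))) 1 := by
  have i0 : Integrable (fun u : ℝ => Real.exp (-(1 * |u| ^ α))) := by
    have := integrable_abs _ (int_m α 0 1 hα one_pos (by norm_num))
    simpa using this
  have i1 : Integrable (fun u : ℝ => |u| ^ α * Real.exp (-((1/2) * |u| ^ α))) :=
    integrable_abs _ (int_m α α (1/2) hα (by norm_num) (by linarith))
  have := (hasDerivAt_integral_of_dominated_loc_of_deriv_le (μ := volume)
    (F := fun (r : ℝ) (u : ℝ) => Real.cos (z * u) * Real.exp (-(r * |u| ^ α)))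
    (F' := fun (r : ℝ) (u : ℝ) => Real.cos (z * u) * (-(|u| ^ α) * Real.exp (-(r * |u| ^ α))))
    (x₀ := 1) (s := Ioi (1/2)) (bound := fun u : ℝ => |u| ^ α * Real.exp (-((1/2) * |u| ^ α)))
    (Ioi_mem_nhds (by norm_num)) ?_ ?_ ?_ ?_ i1 ?_).2
  · simpa using this
  · exact Eventually.of_forall fun r => by apply Measurable.aestronglyMeasurable; fun_prop
  · exact i0.bdd_mul (c := 1) (by apply Measurable.aestronglyMeasurable; fun_prop)
      (Eventually.of_forall fun p => by simpa using Real.abs_cos_le_one _)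
  · apply Measurable.aestronglyMeasurable; fun_prop
  · refine Eventually.of_forall fun u r hr => ?_
    rw [norm_mul, norm_mul, norm_neg, Real.norm_eq_abs, Real.norm_eq_abs, Real.norm_eq_abs, Real.abs_exp,
      abs_of_nonneg (by positivity : 0 ≤ |u| ^ α)]
    have h1 : Real.exp (-(r * |u| ^ α)) ≤ Real.exp (-((1/2) * |u| ^ α)) := by
      apply Real.exp_le_exp.2
      have : (1/2) * |u| ^ α ≤ r * |u| ^ α := mul_le_mul_of_nonneg_right (le_of_lt hr) (by positivity)
      linarith
    calc _ ≤ 1 * (|u| ^ α * Real.exp (-((1/2) * |u| ^ α))) := by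
          gcongr
          exact Real.abs_cos_le_one _
      _ = _ := one_mul _
  · refine Eventually.of_forall fun u r hr => ?_
    have h1 : HasDerivAt (fun r : ℝ => -(r * |u| ^ α)) (-(|u| ^ α)) r := by
      have := ((hasDerivAt_id r).mul_const (|u| ^ α)).neg
      rw [one_mul] at this
      exact this
    have := (h1.exp).const_mul (Real.cos (z * u))
    exact this.congr_deriv (by ring)

lemma stable_scale (α z s : ℝ) (hs : 0 < s) :
    s * stableDensity α (s * z) =
      (2 * Real.pi)⁻¹ * ∫ u : ℝ, Real.cos (z * u) * Real.exp (-(s ^ (-α) * |u| ^ α)) := by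
  unfold stableDensity
  have := Measure.integral_comp_mul_left (fun u => Real.cos (z * u) * Real.exp (-(s ^ (-α) * |u| ^ α))) s
  rw [abs_of_pos (by positivity), smul_eq_mul] at this
  have e : ∀ u : ℝ, Real.cos (z * (s * u)) * Real.exp (-(s ^ (-α) * |s * u| ^ α)) =
      Real.cos (s * z * u) * Real.exp (-(|u| ^ α)) := by
    intro u
    rw [abs_mul, abs_of_pos hs, Real.mul_rpow hs.le (abs_nonneg u), ← mul_assoc (s ^ (-α)), ← Real.rpow_add hs]
    rw [show z * (s * u) = s * z * u by ring]; simp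
  simp_rw [e] at this
  rw [this]; field_simp

lemma Dop_stable (α z : ℝ) (hα : 0 < α) (hz : z ≠ 0) :
    Dop (stableDensity α) z =
      (2 * Real.pi)⁻¹ * ∫ u : ℝ, Real.cos (z * u) * (α * (|u| ^ α * Real.exp (-(|u| ^ α)))) := by
  set I0 := ∫ u : ℝ, Real.cos (z * u) * (|u| ^ α * Real.exp (-(|u| ^ α))) with hI0
  have hF : HasDerivAt (fun s : ℝ => s * stableDensity α (s * z)) ((2 * Real.pi)⁻¹ * (α * I0)) 1 := by
    have h1 : HasDerivAt (fun s : ℝ => s ^ (-α)) (-α) 1 := by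
      have := Real.hasDerivAt_rpow_const (x := 1) (p := -α) (Or.inl one_ne_zero)
      simpa using this
    have hQ := Q_deriv α z hα
    rw [show (1:ℝ) = (1:ℝ) ^ (-α) by simp] at hQ
    have h2 := (HasDerivAt.comp (1:ℝ) hQ h1).const_mul (2 * Real.pi)⁻¹
    have h3 : (∫ u : ℝ, Real.cos (z * u) * (-(|u| ^ α) * Real.exp (-(|u| ^ α)))) = - I0 := by
      rw [hI0, ← integral_neg]; congr 1; ext u; ring
    rw [h3] at h2
    have h4 : (2 * Real.pi)⁻¹ * (-I0 * -α) = (2 * Real.pi)⁻¹ * (α * I0) := by ring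
    rw [h4] at h2
    refine h2.congr_of_eventuallyEq ?_
    filter_upwards [Ioi_mem_nhds (show (0:ℝ) < 1 by norm_num)] with s hs
    exact stable_scale α z s hs
  have h5 : HasDerivAt (fun x : ℝ => x / z) (1 / z) z := by
    simpa using (hasDerivAt_id z).div_const z
  have hF' : HasDerivAt (fun s : ℝ => s * stableDensity α (s * z)) ((2 * Real.pi)⁻¹ * (α * I0)) (z / z) := by
    rwa [div_self hz]
  have h6 := HasDerivAt.comp (h := fun x : ℝ => x / z) z hF' h5
  have h7 : HasDerivAt (fun x : ℝ => z * x⁻¹) (z * (-(z ^ 2)⁻¹)) z := (hasDerivAt_inv hz).const_mul z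
  have h8 := h7.mul h6
  have hee : stableDensity α =ᶠ[𝓝 z] ((fun x => z * x⁻¹) * (fun s => s * stableDensity α (s * z)) ∘ fun x => x / z) := by
    filter_upwards [isOpen_ne.mem_nhds hz] with x hx
    have hx' : x ≠ 0 := hx
    simp only [Pi.mul_apply, Function.comp_apply]
    rw [div_mul_cancel₀ _ hz]; field_simp
  have h9 := h8.congr_of_eventuallyEq hee
  unfold Dop
  rw [h9.deriv]
  have e : (∫ u : ℝ, Real.cos (z * u) * (α * (|u| ^ α * Real.exp (-(|u| ^ α))))) = α * I0 := by
    rw [hI0, ← integral_const_mul]; congr 1; ext u; ring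
  rw [e]
  simp only [Function.comp_apply]
  rw [div_self hz, one_mul]
  field_simp
  ring

lemma gauss_half (y : ℝ) :
    gauss y = Real.pi⁻¹ * ∫ t in Ioi (0:ℝ), Real.cos (t * y) * Real.exp (-(t ^ 2) / 2) := by
  have h := gauss_cos y 0
  simp only [zero_sub, mul_neg, Real.cos_neg, mul_zero, Real.cos_zero, one_mul] at h
  have h2 := integral_comp_abs (f := fun t => Real.cos (t * y) * Real.exp (-(t ^ 2) / 2))
  simp only [cos_abs_mul, sq_abs] at h2
  have h3 : (∫ x : ℝ, gauss x * Real.cos (y * x)) =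
      (Real.sqrt (2 * Real.pi))⁻¹ * ∫ x : ℝ, Real.cos (x * y) * Real.exp (-(x ^ 2) / 2) := by
    rw [← integral_const_mul]; congr 1; ext x; unfold gauss; rw [mul_comm y x]; ring
  rw [h2] at h3
  have hs : Real.sqrt (2 * Real.pi) ^ 2 = 2 * Real.pi := Real.sq_sqrt (by positivity)
  have hs0 : Real.sqrt (2 * Real.pi) ≠ 0 := by positivity
  have hp : Real.pi = Real.sqrt (2 * Real.pi) ^ 2 / 2 := by rw [hs]; ring
  unfold gauss
  rw [← h, h3]
  generalize (∫ t in Ioi (0:ℝ), Real.cos (t * y) * Real.exp (-(t ^ 2) / 2)) = J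
  have : Real.pi⁻¹ = 2 * ((Real.sqrt (2 * Real.pi))⁻¹) ^ 2 := by
    rw [inv_pow, hs]; field_simp
  rw [this]; ring

end

section

/-- oscillating kernel in logarithmic coordinate -/
def Ek (y : ℝ) (ζ : ℂ) : ℂ := Complex.exp (Complex.I * y * Complex.exp ζ)
def Ak (ζ : ℂ) : ℂ := Complex.exp (-(Complex.exp (2 * ζ) / 2))
def Xk (q α : ℝ) (ζ : ℂ) : ℂ := q * Complex.exp (α * ζ)
def G1 (q α : ℝ) (ζ : ℂ) : ℂ := Ak ζ * (Complex.exp (-(Xk q α ζ)) - 1)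
def P2 (α b : ℝ) (ζ : ℂ) : ℂ := Complex.exp (α * ζ) * (b + ζ)
def G2 (q α b : ℝ) (ζ : ℂ) : ℂ := Ak ζ * Complex.exp (-(Xk q α ζ)) * P2 α b ζ

lemma Ek_diff (y : ℝ) : Differentiable ℂ (Ek y) := by unfold Ek; fun_prop
lemma Ak_diff : Differentiable ℂ Ak := by unfold Ak; fun_prop
lemma Xk_diff (q α : ℝ) : Differentiable ℂ (Xk q α) := by unfold Xk; fun_prop
lemma G1_diff (q α : ℝ) : Differentiable ℂ (G1 q α) := by
  have := Ak_diff; have := Xk_diff q α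
  unfold G1; fun_prop
lemma P2_diff (α b : ℝ) : Differentiable ℂ (P2 α b) := by unfold P2; fun_prop
lemma G2_diff (q α b : ℝ) : Differentiable ℂ (G2 q α b) := by
  have := Ak_diff; have := Xk_diff q α; have := P2_diff α b
  unfold G2; fun_prop

open Complex

lemma norm_Ek (y s θ : ℝ) : ‖Ek y (s + θ * I)‖ = Real.exp (-(y * Real.sin θ * Real.exp s)) := by
  unfold Ek
  rw [Complex.norm_exp]
  congr 1
  rw [mul_assoc, mul_re]
  simp [Complex.exp_im]; ring

lemma Ak_re (s θ : ℝ) : (cexp (2 * (s + θ * I)) / 2).re = Real.exp s ^ 2 * Real.cos (2 * θ) / 2 := by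
  have : Real.exp s ^ 2 = Real.exp (2 * s) := by rw [← Real.exp_nat_mul]; norm_num
  rw [this]
  have h2 : (cexp (2 * (s + θ * I)) / 2).re = (cexp (2 * (s + θ * I))).re / 2 := by
    rw [show (2:ℂ) = ((2:ℝ):ℂ) by norm_num, Complex.div_ofReal_re]
  rw [h2, Complex.exp_re]; simp

lemma Ak_norm' (s θ : ℝ) : ‖cexp (2 * (s + θ * I)) / 2‖ = Real.exp s ^ 2 / 2 := by
  have : Real.exp s ^ 2 = Real.exp (2 * s) := by rw [← Real.exp_nat_mul]; norm_num
  rw [this, norm_div, Complex.norm_exp]; simp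

lemma cos2_ge (θ : ℝ) (h0 : 0 ≤ θ) (h1 : θ ≤ Real.pi / 8) : 1 / 2 ≤ Real.cos (2 * θ) := by
  rw [← Real.cos_pi_div_three]
  apply Real.cos_le_cos_of_nonneg_of_le_pi <;> linarith [Real.pi_pos]

lemma norm_Ak_le (s θ : ℝ) (h0 : 0 ≤ θ) (h1 : θ ≤ Real.pi / 8) :
    ‖Ak (s + θ * I)‖ ≤ Real.exp (-(Real.exp s ^ 2 / 4)) := by
  unfold Ak
  rw [Complex.norm_exp, neg_re, Ak_re]
  apply Real.exp_le_exp.2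
  have := cos2_ge θ h0 h1
  nlinarith [sq_nonneg (Real.exp s)]

lemma norm_Ak_le1 (s θ : ℝ) (h0 : 0 ≤ θ) (h1 : θ ≤ Real.pi / 8) : ‖Ak (s + θ * I)‖ ≤ 1 := by
  refine (norm_Ak_le s θ h0 h1).trans ?_
  rw [← Real.exp_zero]; apply Real.exp_le_exp.2; have := sq_nonneg (Real.exp s); linarith

lemma Xk_norm (q α s θ : ℝ) (hq : 0 ≤ q) : ‖Xk q α (s + θ * I)‖ = q * Real.exp s ^ α := by
  unfold Xk
  rw [norm_mul, Complex.norm_exp, ← Real.exp_mul]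
  simp [abs_of_nonneg hq, mul_comm]

lemma Xk_re (q α s θ : ℝ) (hq : 0 ≤ q) (hα : 0 ≤ α) (hα2 : α ≤ 2) (h0 : 0 ≤ θ) (h1 : θ ≤ Real.pi / 8) :
    0 ≤ (Xk q α (s + θ * I)).re := by
  unfold Xk
  rw [Complex.re_ofReal_mul, Complex.exp_re]
  have : 0 ≤ Real.cos ((α * (s + θ * I) : ℂ).im) := by
    simp
    apply Real.cos_nonneg_of_neg_pi_div_two_le_of_le <;> nlinarith [Real.pi_pos]
  positivity

lemma norm_exp_neg_le (z : ℂ) (hz : 0 ≤ z.re) : ‖cexp (-z)‖ ≤ 1 := by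
  rw [Complex.norm_exp, neg_re, ← Real.exp_zero]
  exact Real.exp_le_exp.2 (by linarith)

lemma convex_half : Convex ℝ {z : ℂ | 0 ≤ z.re} := convex_halfSpace_re_ge 0

lemma exp_neg_bd1 (z : ℂ) (hz : 0 ≤ z.re) : ‖cexp (-z) - 1‖ ≤ ‖z‖ := by
  have := convex_half.norm_image_sub_le_of_norm_hasDerivWithin_le (f := fun z : ℂ => cexp (-z))
    (f' := fun z => -cexp (-z)) (C := 1) (x := 0) (y := z)
    (fun x _ => by
      have := ((hasDerivAt_id x).neg).cexp
      exact (this.congr_deriv (by simp)).hasDerivWithinAt)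
    (fun x hx => by rw [norm_neg]; exact norm_exp_neg_le x hx) (by simp) hz
  simpa using this

lemma exp_neg_bd2 (z : ℂ) (hz : 0 ≤ z.re) : ‖cexp (-z) - 1 + z‖ ≤ ‖z‖ ^ 2 := by
  have := (convex_half.inter (convex_closedBall (0:ℂ) ‖z‖)).norm_image_sub_le_of_norm_hasDerivWithin_le
    (f := fun z : ℂ => cexp (-z) + z)
    (f' := fun z => -cexp (-z) + 1) (C := ‖z‖) (x := 0) (y := z)
    (fun x _ => by
      have := (((hasDerivAt_id x).neg).cexp).add (hasDerivAt_id x)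
      exact (this.congr_deriv (by simp)).hasDerivWithinAt)
    (fun x hx => by
      have h1 := exp_neg_bd1 x hx.1
      have h2 : ‖x‖ ≤ ‖z‖ := by simpa using hx.2
      rw [show -cexp (-x) + 1 = -(cexp (-x) - 1) by ring, norm_neg]; linarith) (by simp) ⟨hz, by simp⟩
  simp only [neg_zero, Complex.exp_zero, add_zero, sub_zero] at this
  rw [sq, show cexp (-z) - 1 + z = cexp (-z) + z - 1 by ring]
  exact this

lemma norm_P2_le (α b s θ : ℝ) (h0 : 0 ≤ θ) (h1 : θ ≤ Real.pi / 2) :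
    ‖P2 α b (s + θ * I)‖ ≤ Real.exp s ^ α * (|b| + 2 + |s|) := by
  unfold P2
  rw [norm_mul, Complex.norm_exp, ← Real.exp_mul]
  have e : (α * (s + θ * I) : ℂ).re = s * α := by simp [mul_comm]
  rw [e]
  have hθ : ‖(θ * I : ℂ)‖ ≤ 2 := by
    simp [abs_of_nonneg h0]; linarith [Real.pi_le_four]
  have hb : ‖(b:ℂ)‖ = |b| := by simp
  have hs : ‖(s:ℂ)‖ = |s| := by simp
  have n1 := norm_add_le (b:ℂ) (s + θ * I)
  have n2 := norm_add_le (s:ℂ) (θ * I)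
  apply mul_le_mul_of_nonneg_left _ (Real.exp_pos _).le
  linarith

lemma rpow_le_poly (t a : ℝ) (ht : 0 < t) (ha : 0 ≤ a) (ha4 : a ≤ 4) : t ^ a ≤ 1 + t ^ 4 := by
  rcases le_total t 1 with h | h
  · have := Real.rpow_le_one ht.le h ha
    have : 0 ≤ t ^ 4 := by positivity
    linarith
  · have := Real.rpow_le_rpow_of_exponent_le h ha4
    have e : t ^ (4:ℝ) = t ^ (4:ℕ) := by exact_mod_cast Real.rpow_natCast t 4
    rw [e] at this; linarith

lemma poly_log_bound (α B s : ℝ) (hα : 0 < α) (hα2 : α < 2) (hB : 0 ≤ B) :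
    Real.exp s ^ α * (B + |s|) ≤ (B + 2 / α) * (1 + Real.exp s ^ 4) := by
  set t := Real.exp s with ht
  have htp : 0 < t := Real.exp_pos s
  have hl := abs_log_le t α htp hα
  rw [ht, Real.log_exp, ← ht] at hl
  have e : t ^ α * t ^ (-α) = 1 := by rw [← Real.rpow_add htp]; simp
  have e2 : t ^ α * t ^ α = t ^ (2 * α) := by rw [← Real.rpow_add htp]; ring_nf
  have h1 := rpow_le_poly t α htp hα.le (by linarith)
  have h2 := rpow_le_poly t (2 * α) htp (by linarith) (by linarith)
  have h4 : 0 ≤ t ^ 4 := by positivity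
  calc t ^ α * (B + |s|) ≤ t ^ α * (B + (t ^ α + t ^ (-α)) / α) := by gcongr
    _ = t ^ α * B + (t ^ α * t ^ α + t ^ α * t ^ (-α)) / α := by ring
    _ = t ^ α * B + (t ^ (2 * α) + 1) / α := by rw [e, e2]
    _ ≤ (1 + t ^ 4) * B + ((1 + t ^ 4) + (1 + t ^ 4)) / α := by gcongr; linarith
    _ = _ := by ring

lemma gaussexp_le (t : ℝ) : Real.exp (-(t ^ 2 / 4)) ≤ Real.exp 1 * Real.exp (-(1 * t)) := by
  rw [← Real.exp_add]; apply Real.exp_le_exp.2; nlinarith [sq_nonneg (t / 2 - 1)]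

lemma Ek_le_one (y s θ : ℝ) (hy : 0 ≤ y) (h0 : 0 ≤ θ) (h1 : θ ≤ Real.pi) : ‖Ek y (s + θ * I)‖ ≤ 1 := by
  rw [norm_Ek, ← Real.exp_zero]
  apply Real.exp_le_exp.2
  have := Real.sin_nonneg_of_nonneg_of_le_pi h0 h1
  have : 0 ≤ y * Real.sin θ * Real.exp s := by positivity
  linarith

lemma bound_EG1 (q α y s θ : ℝ) (hq : 0 ≤ q) (hα : 0 < α) (hα2 : α < 2) (hy : 0 ≤ y)
    (h0 : 0 ≤ θ) (h1 : θ ≤ Real.pi / 8) :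
    ‖Ek y (s + θ * I) * G1 q α (s + θ * I)‖ ≤
      (2 * Real.exp 1) * (1 + Real.exp s ^ 4) * Real.exp (-(1 * Real.exp s)) := by
  have b1 := Ek_le_one y s θ hy h0 (by linarith [Real.pi_pos])
  have b2 := (norm_Ak_le s θ h0 h1).trans (gaussexp_le (Real.exp s))
  have b3 : ‖cexp (-(Xk q α (s + θ * I))) - 1‖ ≤ 2 := by
    refine (norm_sub_le _ _).trans ?_
    have := norm_exp_neg_le _ (Xk_re q α s θ hq hα.le hα2.le h0 h1)
    rw [norm_one]; linarith
  unfold G1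
  rw [norm_mul, norm_mul]
  calc _ ≤ 1 * ((Real.exp 1 * Real.exp (-(1 * Real.exp s))) * 2) := by gcongr
    _ = (2 * Real.exp 1) * 1 * Real.exp (-(1 * Real.exp s)) := by ring
    _ ≤ _ := by
      gcongr
      have : 0 ≤ Real.exp s ^ 4 := by positivity
      linarith

lemma bound_EG2 (q α b y s θ : ℝ) (hq : 0 ≤ q) (hα : 0 < α) (hα2 : α < 2) (hy : 0 ≤ y)
    (h0 : 0 ≤ θ) (h1 : θ ≤ Real.pi / 8) :
    ‖Ek y (s + θ * I) * G2 q α b (s + θ * I)‖ ≤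
      (Real.exp 1 * (|b| + 2 + 2 / α)) * (1 + Real.exp s ^ 4) * Real.exp (-(1 * Real.exp s)) := by
  have b1 := Ek_le_one y s θ hy h0 (by linarith [Real.pi_pos])
  have b2 := (norm_Ak_le s θ h0 h1).trans (gaussexp_le (Real.exp s))
  have b3 := norm_exp_neg_le _ (Xk_re q α s θ hq hα.le hα2.le h0 h1)
  have b4 := (norm_P2_le α b s θ h0 (by linarith [Real.pi_pos])).trans
    (poly_log_bound α (|b| + 2) s hα hα2 (by positivity))
  unfold G2
  rw [norm_mul, norm_mul, norm_mul]
  calc _ ≤ 1 * ((Real.exp 1 * Real.exp (-(1 * Real.exp s))) * 1 * ((|b| + 2 + 2 / α) * (1 + Real.exp s ^ 4))) := by gcongr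
    _ = _ := by ring

lemma bound_EP2 (α b y s θ ψ : ℝ) (hα : 0 < α) (hα2 : α < 2) (hy : 0 < y) (hψ : 0 ≤ ψ)
    (h0 : ψ ≤ θ) (h1 : θ ≤ Real.pi / 2) :
    ‖Ek y (s + θ * I) * P2 α b (s + θ * I)‖ ≤
      (|b| + 2 + 2 / α) * (1 + Real.exp s ^ 4) * Real.exp (-((y * Real.sin ψ) * Real.exp s)) := by
  have b4 := (norm_P2_le α b s θ (by linarith) (by linarith [Real.pi_pos])).trans
    (poly_log_bound α (|b| + 2) s hα hα2 (by positivity))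
  have b1 : ‖Ek y (s + θ * I)‖ ≤ Real.exp (-((y * Real.sin ψ) * Real.exp s)) := by
    rw [norm_Ek]
    have := Real.sin_le_sin_of_le_of_le_pi_div_two (by linarith [Real.pi_pos]) h1 h0
    gcongr
  rw [norm_mul]
  calc _ ≤ Real.exp (-((y * Real.sin ψ) * Real.exp s)) * ((|b| + 2 + 2 / α) * (1 + Real.exp s ^ 4)) := by gcongr
    _ = _ := by ring

end

section

def dF (q α y : ℝ) : ℝ :=
  Real.pi⁻¹ * ∫ t in Ioi (0:ℝ), Real.cos (t * y) * (Real.exp (-(t ^ 2) / 2) * (Real.exp (-(q * t ^ α)) - 1))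

def dL (q α b y : ℝ) : ℝ :=
  Real.pi⁻¹ * ∫ t in Ioi (0:ℝ), Real.cos (t * y) *
    (Real.exp (-(t ^ 2) / 2) * Real.exp (-(q * t ^ α)) * (t ^ α * (b + Real.log t)))

lemma dF_even (q α y : ℝ) : dF q α (-y) = dF q α y := by
  unfold dF; simp only [mul_neg, Real.cos_neg]
lemma dL_even (q α b y : ℝ) : dL q α b (-y) = dL q α b y := by
  unfold dL; simp only [mul_neg, Real.cos_neg]

/-- elementary bound for t>0 -/
lemma exp_q_bd (q x : ℝ) (hq : 0 ≤ q) (hx : 0 ≤ x) : |Real.exp (-(q * x)) - 1| ≤ q * x := by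
  have h1 := Real.add_one_le_exp (-(q * x))
  have h2 : Real.exp (-(q * x)) ≤ 1 := by
    rw [← Real.exp_zero]; apply Real.exp_le_exp.2; have := mul_nonneg hq hx; linarith
  rw [abs_le]; constructor <;> linarith [mul_nonneg hq hx]

lemma gauss2_le (t : ℝ) : Real.exp (-(t ^ 2) / 2) ≤ Real.exp 1 * Real.exp (-(1 * t)) := by
  rw [← Real.exp_add]; apply Real.exp_le_exp.2; nlinarith [sq_nonneg (t  - 1)]

def KF (α : ℝ) : ℝ := ∫ t in Ioi (0:ℝ), (Real.exp 1 * (2 + 2 / α)) * (1 + t ^ 4) * Real.exp (-(1 * t))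

lemma KF_int (α : ℝ) : IntegrableOn (fun t : ℝ => (Real.exp 1 * (2 + 2 / α)) * (1 + t ^ 4) * Real.exp (-(1 * t))) (Ioi 0) :=
  integrableOn_G _ 1 one_pos

lemma KF_nonneg (α : ℝ) (hα : 0 < α) : 0 ≤ KF α := by
  unfold KF
  apply setIntegral_nonneg measurableSet_Ioi
  intro t ht; positivity

lemma bdF (q α t : ℝ) (hq : 0 ≤ q) (hα : 0 < α) (hα2 : α < 2) (ht : 0 < t) :
    ‖Real.exp (-(t ^ 2) / 2) * (Real.exp (-(q * t ^ α)) - 1)‖ ≤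
      q * ((Real.exp 1 * (2 + 2 / α)) * (1 + t ^ 4) * Real.exp (-(1 * t))) := by
  have h1 := exp_q_bd q (t ^ α) hq (by positivity)
  have h2 := gauss2_le t
  have h3 := rpow_le_poly t α ht hα.le (by linarith)
  rw [norm_mul, Real.norm_eq_abs, Real.norm_eq_abs, Real.abs_exp]
  have h4 : (1:ℝ) ≤ 2 + 2 / α := by
    have : 0 < 2 / α := by positivity
    linarith
  calc _ ≤ (Real.exp 1 * Real.exp (-(1 * t))) * (q * (1 + t ^ 4)) := by
        gcongr; exact h1.trans (by gcongr)
    _ = q * ((Real.exp 1 * 1) * (1 + t ^ 4) * Real.exp (-(1 * t))) := by ring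
    _ ≤ _ := by gcongr

lemma bdL (q α b t : ℝ) (hq : 0 ≤ q) (hα : 0 < α) (hα2 : α < 2) (ht : 0 < t) :
    ‖Real.exp (-(t ^ 2) / 2) * Real.exp (-(q * t ^ α)) * (t ^ α * (b + Real.log t))‖ ≤
      (1 + |b|) * ((Real.exp 1 * (2 + 2 / α)) * (1 + t ^ 4) * Real.exp (-(1 * t))) := by
  have h2 := gauss2_le t
  have h1 : Real.exp (-(q * t ^ α)) ≤ 1 := by
    rw [← Real.exp_zero]; apply Real.exp_le_exp.2
    have : 0 ≤ q * t ^ α := by positivity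
    linarith
  have h3 := poly_log_bound α |b| (Real.log t) hα hα2 (abs_nonneg b)
  rw [Real.exp_log ht] at h3
  have h5 : |t ^ α * (b + Real.log t)| ≤ (|b| + 2 / α) * (1 + t ^ 4) := by
    rw [abs_mul, abs_of_pos (by positivity)]
    refine le_trans ?_ h3
    gcongr; exact abs_add_le _ _
  rw [norm_mul, norm_mul, Real.norm_eq_abs, Real.norm_eq_abs, Real.norm_eq_abs, Real.abs_exp, Real.abs_exp]
  have h6 : |b| + 2 / α ≤ (1 + |b|) * (2 + 2 / α) := by
    have : 0 < 2 / α := by positivity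
    have := abs_nonneg b
    nlinarith
  calc _ ≤ (Real.exp 1 * Real.exp (-(1 * t))) * 1 * ((|b| + 2 / α) * (1 + t ^ 4)) := by gcongr
    _ ≤ (Real.exp 1 * Real.exp (-(1 * t))) * 1 * (((1 + |b|) * (2 + 2 / α)) * (1 + t ^ 4)) := by gcongr
    _ = _ := by ring

lemma cos_integral_bound (m B : ℝ → ℝ) (y : ℝ) (hB : IntegrableOn B (Ioi 0))
    (hb : ∀ t, 0 < t → ‖m t‖ ≤ B t) :
    |Real.pi⁻¹ * ∫ t in Ioi (0:ℝ), Real.cos (t * y) * m t| ≤ ∫ t in Ioi (0:ℝ), B t := by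
  have h : ‖∫ t in Ioi (0:ℝ), Real.cos (t * y) * m t‖ ≤ ∫ t in Ioi (0:ℝ), B t := by
    refine norm_integral_le_of_norm_le hB ?_
    refine (ae_restrict_iff' measurableSet_Ioi).2 (Eventually.of_forall fun t (ht : 0 < t) => ?_)
    rw [norm_mul]
    have := Real.abs_cos_le_one (t * y)
    have h2 := hb t ht
    rw [Real.norm_eq_abs]
    nlinarith [norm_nonneg (m t)]
  rw [Real.norm_eq_abs] at h
  rw [abs_mul, abs_of_pos (by positivity)]
  have : Real.pi⁻¹ ≤ 1 := inv_le_one_of_one_le₀ (by linarith [Real.pi_gt_three])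
  nlinarith [abs_nonneg (∫ t in Ioi (0:ℝ), Real.cos (t * y) * m t)]

lemma cos_integral_cont (m B : ℝ → ℝ) (hm : Measurable m) (hB : IntegrableOn B (Ioi 0))
    (hb : ∀ t, 0 < t → ‖m t‖ ≤ B t) :
    Continuous fun y => Real.pi⁻¹ * ∫ t in Ioi (0:ℝ), Real.cos (t * y) * m t := by
  refine continuous_const.mul (continuous_of_dominated (bound := B) ?_ ?_ hB ?_)
  · intro y; apply Measurable.aestronglyMeasurable; fun_prop
  · intro y
    refine (ae_restrict_iff' measurableSet_Ioi).2 (Eventually.of_forall fun t (ht : 0 < t) => ?_)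
    rw [norm_mul]
    have := Real.abs_cos_le_one (t * y)
    have h2 := hb t ht
    rw [Real.norm_eq_abs]
    nlinarith [norm_nonneg (m t)]
  · refine Eventually.of_forall fun t => ?_
    fun_prop

lemma dF_bound (q α y : ℝ) (hq : 0 ≤ q) (hα : 0 < α) (hα2 : α < 2) : |dF q α y| ≤ KF α * q := by
  have := cos_integral_bound _ _ y ((KF_int α).const_mul q) (fun t ht => bdF q α t hq hα hα2 ht)
  rw [integral_const_mul] at this
  unfold dF KF; linarith

lemma dL_bound (q α b y : ℝ) (hq : 0 ≤ q) (hα : 0 < α) (hα2 : α < 2) : |dL q α b y| ≤ KF α * (1 + |b|) := by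
  have := cos_integral_bound _ _ y ((KF_int α).const_mul (1 + |b|)) (fun t ht => bdL q α b t hq hα hα2 ht)
  rw [integral_const_mul] at this
  unfold dL KF; linarith

lemma dF_cont (q α : ℝ) (hq : 0 ≤ q) (hα : 0 < α) (hα2 : α < 2) : Continuous (dF q α) :=
  cos_integral_cont _ _ (by fun_prop) ((KF_int α).const_mul q) (fun t ht => bdF q α t hq hα hα2 ht)

lemma dL_cont (q α b : ℝ) (hq : 0 ≤ q) (hα : 0 < α) (hα2 : α < 2) : Continuous (dL q α b) :=
  cos_integral_cont _ _ (by fun_prop) ((KF_int α).const_mul (1 + |b|)) (fun t ht => bdL q α b t hq hα hα2 ht)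

lemma fFun_eq (α y w : ℝ) (hα : 0 < α) (hα2 : α < 2) (hw : 0 < w) :
    fFun α y w = gauss y + dF (w ^ α) α y := by
  have h := conv_half (fun t => Real.exp (-(t ^ α))) (by simpa using int_m α 0 1 hα one_pos (by norm_num)) w y hw
  unfold fFun stableDensity
  rw [h, gauss_half, dF, ← mul_add, ← integral_add]
  · congr 1
    apply setIntegral_congr_fun measurableSet_Ioi
    intro t (ht : 0 < t)
    simp only []
    rw [Real.mul_rpow hw.le ht.le]; ring
  · refine (KF_int α).mono' (by apply Measurable.aestronglyMeasurable; fun_prop) ?_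
    refine (ae_restrict_iff' measurableSet_Ioi).2 (Eventually.of_forall fun t (ht : 0 < t) => ?_)
    rw [norm_mul, Real.norm_eq_abs, Real.norm_eq_abs, Real.abs_exp]
    have h1 := Real.abs_cos_le_one (t * y)
    have h2 := gauss2_le t
    have h4 : (1:ℝ) ≤ 2 + 2 / α := by
      have : 0 < 2 / α := by positivity
      linarith
    have h5 : (1:ℝ) ≤ 1 + t ^ 4 := by
      have : 0 ≤ t ^ 4 := by positivity
      linarith
    calc _ ≤ 1 * (Real.exp 1 * Real.exp (-(1 * t))) := by gcongr
      _ = (Real.exp 1 * 1) * 1 * Real.exp (-(1 * t)) := by ring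
      _ ≤ _ := by gcongr
  · refine ((KF_int α).const_mul (w ^ α)).mono' (by apply Measurable.aestronglyMeasurable; fun_prop) ?_
    refine (ae_restrict_iff' measurableSet_Ioi).2 (Eventually.of_forall fun t (ht : 0 < t) => ?_)
    have := bdF (w ^ α) α t (by positivity) hα hα2 ht
    have h1 := Real.abs_cos_le_one (t * y)
    rw [norm_mul, Real.norm_eq_abs (Real.cos _)]
    nlinarith [norm_nonneg (Real.exp (-(t ^ 2) / 2) * (Real.exp (-(w ^ α * t ^ α)) - 1))]

lemma hk_eq (α y w A : ℝ) (hα : 0 < α) (hα2 : α < 2) (hw : 0 < w) :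
    A * hFun α y w + kFun α y w = -(w ^ α) * dL (w ^ α) α (-(α * A) + Real.log w) y := by
  have i1 : IntegrableOn (fun t : ℝ => α * (t ^ α * Real.exp (-(t ^ α)))) (Ioi 0) := by
    have := (int_m α α 1 hα one_pos (by linarith)).const_mul α
    simp only [one_mul] at this
    exact this
  have i2 := int_mlog α hα
  have hh := conv_half _ i1 w y hw
  have hk := conv_half _ i2 w y hw
  have eh : hFun α y w = ∫ z : ℝ, gauss (y - w * z) * ((2 * Real.pi)⁻¹ * ∫ u : ℝ, Real.cos (z * u) * (α * (|u| ^ α * Real.exp (-(|u| ^ α))))) := by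
    unfold hFun
    apply integral_congr_ae
    have : ∀ᵐ z : ℝ, z ≠ 0 := by simp [ae_iff]
    filter_upwards [this] with z hz
    rw [Dop_stable α z hα hz]
  have ek : kFun α y w = -∫ z : ℝ, gauss (y - w * z) * ((2 * Real.pi)⁻¹ * ∫ u : ℝ, Real.cos (z * u) * (|u| ^ α * Real.log |u| * Real.exp (-(|u| ^ α)))) := by
    unfold kFun stableDensityDalpha
    rw [← integral_neg]
    congr 1; ext z
    rw [show (∫ u : ℝ, Real.cos (z * u) * |u| ^ α * Real.log |u| * Real.exp (-(|u| ^ α))) =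
      ∫ u : ℝ, Real.cos (z * u) * (|u| ^ α * Real.log |u| * Real.exp (-(|u| ^ α))) by
        congr 1; ext u; ring]
    ring
  rw [eh, ek, hh, hk]
  have j : ∀ m : ℝ → ℝ, Measurable m → IntegrableOn m (Ioi 0) →
      IntegrableOn (fun t => Real.cos (t * y) * Real.exp (-(t ^ 2) / 2) * m (w * t)) (Ioi 0) := by
    intro m hmm hm
    have h0 : IntegrableOn (fun t => m (w * t)) (Ioi 0) := by
      have := (integrableOn_Ioi_comp_mul_left_iff m 0 hw).2 (by simpa using hm)
      exact this
    refine h0.norm.mono' (by apply Measurable.aestronglyMeasurable; fun_prop) (Eventually.of_forall fun t => ?_)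
    rw [norm_mul, norm_mul, Real.norm_eq_abs (Real.cos _), Real.norm_eq_abs (Real.exp _), Real.abs_exp]
    have h1 := Real.abs_cos_le_one (t * y)
    have h2 : Real.exp (-(t ^ 2) / 2) ≤ 1 := by
      rw [← Real.exp_zero]; apply Real.exp_le_exp.2; nlinarith [sq_nonneg t]
    calc _ ≤ 1 * 1 * ‖m (w * t)‖ := by gcongr
      _ = _ := by ring
  have j1 := j _ (by fun_prop) i1
  have j2 := j _ (by fun_prop) i2
  unfold dL
  rw [show ∀ x z : ℝ, A * (Real.pi⁻¹ * x) + -(Real.pi⁻¹ * z) = Real.pi⁻¹ * (A * x - z) by intros; ring,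
    ← integral_const_mul, ← integral_sub (j1.const_mul A) j2,
    show ∀ z : ℝ, -w ^ α * (Real.pi⁻¹ * z) = Real.pi⁻¹ * (-w ^ α * z) by intros; ring]
  congr 1
  rw [← integral_const_mul]
  apply setIntegral_congr_fun measurableSet_Ioi
  intro t (ht : 0 < t)
  simp only []
  rw [Real.mul_rpow hw.le ht.le, Real.log_mul hw.ne' ht.ne']; ring

end

section

lemma ke_int (a c : ℝ) (ha : -1 < a) (hc : 0 < c) :
    ∫ t in Ioi (0:ℝ), t ^ a * Real.exp (-(c * t)) = Real.Gamma (a + 1) * c ^ (-(a + 1)) := by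
  have := Real.integral_rpow_mul_exp_neg_mul_Ioi (a := a + 1) (r := c) (by linarith) hc
  simp only [add_sub_cancel_right] at this
  rw [this, one_div, Real.inv_rpow hc.le, ← Real.rpow_neg hc.le]; ring

def gamD (α : ℝ) : ℝ := ∫ t in Ioi (0:ℝ), t ^ α * Real.log t * Real.exp (-t)

lemma gamD_int (α : ℝ) (hα : 0 < α) (c : ℝ) (hc : 0 < c) : IntegrableOn (fun t : ℝ => t ^ α * Real.log t * Real.exp (-(c * t))) (Ioi 0) := by
  have h1 := integrableOn_rpow_exp (a := 2 * α) (c := c) (by linarith) hc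
  have h2 := integrableOn_rpow_exp (a := 0) (c := c) (by norm_num) hc
  refine ((h1.add h2).const_mul (1 / α)).mono' (by
    apply Measurable.aestronglyMeasurable; fun_prop) ?_
  refine (ae_restrict_iff' measurableSet_Ioi).2 (Eventually.of_forall fun t (ht : 0 < t) => ?_)
  have := abs_log_le t α ht hα
  rw [norm_mul, norm_mul, Real.norm_eq_abs, Real.norm_eq_abs, Real.norm_eq_abs, Real.abs_exp, abs_of_pos (Real.rpow_pos_of_pos ht α)]
  have e : t ^ α * t ^ (-α) = 1 := by rw [← Real.rpow_add ht]; simp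
  have e2 : t ^ α * t ^ α = t ^ (2 * α) := by rw [← Real.rpow_add ht]; ring_nf
  have : t ^ α * |Real.log t| ≤ 1 / α * (t ^ (2 * α) + 1) := by
    calc _ ≤ t ^ α * ((t ^ α + t ^ (-α)) / α) := by gcongr
      _ = 1 / α * (t ^ α * t ^ α + t ^ α * t ^ (-α)) := by ring
      _ = _ := by rw [e, e2]
  simp only [Pi.add_apply, Real.rpow_zero]
  calc _ ≤ 1 / α * (t ^ (2 * α) + 1) * Real.exp (-(c * t)) := by gcongr
    _ = _ := by ring

lemma gamD_deriv (α : ℝ) (hα : 0 < α) : HasDerivAt (fun x => Real.Gamma (x + 1)) (gamD α) α := by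
  have h := Complex.hasDerivAt_GammaIntegral (s := ((α + 1 : ℝ) : ℂ)) (by simp; linarith)
  have h2 : HasDerivAt Complex.Gamma (gamD α : ℂ) ((α + 1 : ℝ) : ℂ) := by
    have e : Complex.Gamma =ᶠ[𝓝 ((α + 1 : ℝ) : ℂ)] Complex.GammaIntegral := by
      have : {z : ℂ | 0 < z.re} ∈ 𝓝 ((α + 1 : ℝ) : ℂ) := by
        apply (isOpen_lt continuous_const Complex.continuous_re).mem_nhds
        simp; linarith
      filter_upwards [this] with z hz
      exact Complex.Gamma_eq_integral hz
    refine (h.congr_of_eventuallyEq e).congr_deriv ?_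
    rw [gamD, ← integral_complex_ofReal]
    apply setIntegral_congr_fun measurableSet_Ioi
    intro t (ht : 0 < t)
    simp only []
    push_cast
    rw [add_sub_cancel_right, Complex.ofReal_cpow ht.le]; ring
  have h3 : HasDerivAt Real.Gamma (gamD α) (α + 1) := by
    have := h2.real_of_complex
    simpa [Complex.Gamma_ofReal] using this
  have := h3.comp_add_const α 1
  exact this

lemma log_int (α y : ℝ) (hy : 0 < y) :
    ∫ t in Ioi (0:ℝ), t ^ α * Real.log t * Real.exp (-(y * t)) =
      y ^ (-(α + 1)) * ∫ t in Ioi (0:ℝ), t ^ α * (Real.log t - Real.log y) * Real.exp (-t) := by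
  have := integral_comp_mul_left_Ioi (fun u => u ^ α * (Real.log u - Real.log y) * Real.exp (-u)) 0 hy
  rw [mul_zero, smul_eq_mul] at this
  rw [neg_add, Real.rpow_add hy, Real.rpow_neg_one, mul_assoc, ← this, ← integral_const_mul]
  apply setIntegral_congr_fun measurableSet_Ioi
  intro t (ht : 0 < t)
  simp only []
  rw [Real.mul_rpow hy.le ht.le, Real.log_mul hy.ne' ht.ne', Real.rpow_neg hy.le]
  have := (Real.rpow_pos_of_pos hy α).ne'
  field_simp; ring

lemma log_int2 (α y : ℝ) (hα : 0 < α) (hy : 0 < y) :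
    ∫ t in Ioi (0:ℝ), t ^ α * Real.log t * Real.exp (-(y * t)) =
      y ^ (-(α + 1)) * (gamD α - Real.log y * Real.Gamma (α + 1)) := by
  rw [log_int α y hy]
  congr 1
  have i1 := gamD_int α hα 1 one_pos
  have i2 := integrableOn_rpow_exp (a := α) (c := 1) (by linarith) one_pos
  have e2 := ke_int α 1 (by linarith) one_pos
  simp only [one_mul, Real.one_rpow, mul_one] at i1 i2 e2
  rw [gamD, ← e2, ← integral_const_mul, ← integral_sub i1 (i2.const_mul _)]
  congr 1; ext t; ring

def cc (α : ℝ) : ℝ := Real.Gamma (α + 1) * Real.sin (Real.pi * α / 2) / Real.pi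
def cd (α : ℝ) : ℝ := gamD α * Real.sin (Real.pi * α / 2) / Real.pi + Real.Gamma (α + 1) * Real.cos (Real.pi * α / 2) / 2

lemma cc_deriv (α : ℝ) (hα : 0 < α) : HasDerivAt cc (cd α) α := by
  have h1 := gamD_deriv α hα
  have h2 : HasDerivAt (fun x => Real.sin (Real.pi * x / 2)) (Real.cos (Real.pi * α / 2) * (Real.pi / 2)) α := by
    have := (((hasDerivAt_id α).const_mul Real.pi).div_const 2).sin
    simpa using this
  have := (h1.mul h2).div_const Real.pi
  refine this.congr_deriv ?_
  unfold cd
  field_simp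

lemma cAlpha_eq (α : ℝ) (h0 : 0 < α) (h2 : α < 2) : cAlpha α = cc α := by
  unfold cAlpha cc
  split_ifs with h
  · subst h; norm_num [Real.Gamma_two]
  · have hG : Real.Gamma (2 - α) = (1 - α) * Real.Gamma (1 - α) := by
      rw [← Real.Gamma_add_one (by intro h'; apply h; linarith)]; ring_nf
    have hG2 : Real.Gamma (α + 1) = α * Real.Gamma α := Real.Gamma_add_one h0.ne'
    have hr := Real.Gamma_mul_Gamma_one_sub α
    have hs : Real.sin (Real.pi * α) = 2 * Real.sin (Real.pi * α / 2) * Real.cos (Real.pi * α / 2) := by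
      rw [← Real.sin_two_mul]; ring_nf
    have hsp : 0 < Real.sin (Real.pi * α / 2) := by
      apply Real.sin_pos_of_pos_of_lt_pi <;> nlinarith [Real.pi_pos]
    have h1α : (1:ℝ) - α ≠ 0 := by intro h'; apply h; linarith
    have hGp : Real.Gamma (2 - α) ≠ 0 := (Real.Gamma_pos_of_pos (by linarith)).ne'
    have hG1 : Real.Gamma (1 - α) ≠ 0 := by
      intro h'; rw [h', mul_zero] at hG; exact hGp hG
    have hGa : Real.Gamma α ≠ 0 := (Real.Gamma_pos_of_pos h0).ne'
    have hc : Real.cos (Real.pi * α / 2) ≠ 0 := by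
      intro h'
      rw [hs, h', mul_zero, div_zero] at hr
      exact (mul_ne_zero hGa hG1) hr
    rw [hs] at hr
    rw [hG, hG2]
    have hpi := Real.pi_ne_zero
    generalize Real.sin (Real.pi * α / 2) = S at *
    generalize Real.cos (Real.pi * α / 2) = Cc at *
    have hS := hsp.ne'
    rw [eq_div_iff (by positivity)] at hr
    rw [div_eq_div_iff (by positivity) (by positivity)]
    linear_combination (α * (α - 1)) * hr

lemma cAlpha_deriv (α : ℝ) (h0 : 0 < α) (h2 : α < 2) : deriv cAlpha α = cd α := by
  have e : cAlpha =ᶠ[𝓝 α] cc := by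
    filter_upwards [Ioo_mem_nhds h0 h2] with x hx
    exact cAlpha_eq x hx.1 hx.2
  rw [e.deriv_eq, (cc_deriv α h0).deriv]

lemma cc_pos (α : ℝ) (h0 : 0 < α) (h2 : α < 2) : 0 < cc α := by
  have hsp : 0 < Real.sin (Real.pi * α / 2) := by
      apply Real.sin_pos_of_pos_of_lt_pi <;> nlinarith [Real.pi_pos]
  have := Real.Gamma_pos_of_pos (show 0 < α + 1 by linarith)
  unfold cc; positivity

end

section

open Complex

def psi : ℝ := Real.pi / 8

/-- integral along the ray of angle θ -/
def ray (θ : ℝ) (g : ℂ → ℂ) : ℂ := ∫ t in Ioi (0:ℝ), cexp (θ * I) * g (Real.log t + θ * I)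

lemma cos_as_ray (g : ℂ → ℂ) (hg : Differentiable ℂ g) (K : ℝ) (y : ℝ) (m : ℝ → ℝ)
    (hbd : ∀ s θ : ℝ, 0 ≤ θ → θ ≤ psi →
      ‖Ek y (s + θ * I) * g (s + θ * I)‖ ≤ K * (1 + Real.exp s ^ 4) * Real.exp (-(1 * Real.exp s)))
    (hm : ∀ t : ℝ, 0 < t → g (Real.log t) = (m t : ℂ)) :
    Real.pi⁻¹ * ∫ t in Ioi (0:ℝ), Real.cos (t * y) * m t = Real.pi⁻¹ * (ray psi (fun ζ => Ek y ζ * g ζ)).re := by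
  congr 1
  have hd : Differentiable ℂ (fun ζ => Ek y ζ * g ζ) := (Ek_diff y).mul hg
  have hψ : (0:ℝ) ≤ psi := by unfold psi; positivity
  have hrot := ray_rotate _ hd K 1 0 psi one_pos hψ hbd
  have hintg := ray_integrable _ hd K 1 0 one_pos (fun s => hbd s 0 le_rfl hψ)
  unfold ray
  rw [← hrot]
  simp only [ofReal_zero, zero_mul, Complex.exp_zero, one_mul, add_zero] at hintg ⊢
  have := integral_re hintg
  simp only [RCLike.re_to_complex] at this
  rw [← this]
  apply setIntegral_congr_fun measurableSet_Ioi
  intro t (ht : 0 < t)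
  simp only []
  rw [hm t ht, Ek, ofReal_log ht.le, Complex.exp_log (by exact_mod_cast ht.ne'), mul_comm _ (m t : ℂ), Complex.re_ofReal_mul,
    show I * (y:ℂ) * t = ((t * y : ℝ) : ℂ) * I by push_cast; ring, Complex.exp_ofReal_mul_I_re]; ring

lemma cexp_rpow (α t : ℝ) (ht : 0 < t) : cexp (α * (Real.log t : ℂ)) = ((t ^ α : ℝ) : ℂ) := by
  rw [Real.rpow_def_of_pos ht]; push_cast; ring_nf

lemma Ak_real (t : ℝ) (ht : 0 < t) : Ak (Real.log t) = ((Real.exp (-(t ^ 2) / 2) : ℝ) : ℂ) := by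
  unfold Ak
  have := cexp_rpow 2 t ht
  push_cast at this
  rw [this]
  rw [show t ^ (2:ℝ) = t ^ (2:ℕ) by exact_mod_cast Real.rpow_natCast t 2]
  push_cast; ring_nf

lemma dF_ray (q α y : ℝ) (hq : 0 ≤ q) (hα : 0 < α) (hα2 : α < 2) (hy : 0 ≤ y) :
    dF q α y = Real.pi⁻¹ * (ray psi (fun ζ => Ek y ζ * G1 q α ζ)).re := by
  refine cos_as_ray _ (G1_diff q α) _ y _ (fun s θ h0 h1 => bound_EG1 q α y s θ hq hα hα2 hy h0 h1) ?_
  intro t ht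
  unfold G1 Xk
  rw [Ak_real t ht, cexp_rpow α t ht]; push_cast; rfl

lemma dL_ray (q α b y : ℝ) (hq : 0 ≤ q) (hα : 0 < α) (hα2 : α < 2) (hy : 0 ≤ y) :
    dL q α b y = Real.pi⁻¹ * (ray psi (fun ζ => Ek y ζ * G2 q α b ζ)).re := by
  refine cos_as_ray _ (G2_diff q α b) _ y _ (fun s θ h0 h1 => bound_EG2 q α b y s θ hq hα hα2 hy h0 h1) ?_
  intro t ht
  unfold G2 Xk P2
  rw [Ak_real t ht, cexp_rpow α t ht]; push_cast; rfl

lemma psi_pos : 0 < psi := by unfold psi; positivity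
lemma psi_sin : 0 < Real.sin psi := by
  apply Real.sin_pos_of_pos_of_lt_pi psi_pos; unfold psi; linarith [Real.pi_pos]

lemma P2_ray (α b y : ℝ) (hα : 0 < α) (hα2 : α < 2) (hy : 0 < y) :
    (ray psi (fun ζ => Ek y ζ * P2 α b ζ)).re =
      -Real.pi * (y ^ (-(α + 1)) * (cc α * (b - Real.log y) + cd α)) := by
  have hd : Differentiable ℂ (fun ζ => Ek y ζ * P2 α b ζ) := (Ek_diff y).mul (P2_diff α b)
  have hψ : psi ≤ Real.pi / 2 := by unfold psi; linarith [Real.pi_pos]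
  have hbd := fun s θ h0 h1 => bound_EP2 α b y s θ psi hα hα2 hy psi_pos.le h0 h1
  have hrot := ray_rotate _ hd _ (y * Real.sin psi) psi (Real.pi / 2) (mul_pos hy psi_sin) hψ hbd
  have hintg := ray_integrable _ hd _ (y * Real.sin psi) (Real.pi / 2) (mul_pos hy psi_sin)
    (fun s => hbd s (Real.pi / 2) hψ le_rfl)
  unfold ray
  rw [hrot]
  have := integral_re (hintg.const_mul (cexp ((Real.pi / 2 : ℝ) * I)))
  simp only [RCLike.re_to_complex] at this
  rw [← this]
  have i1 := integrableOn_rpow_exp (a := α) (c := y) (by linarith) hy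
  have i2 := gamD_int α hα y hy
  have e1 := ke_int α y (by linarith) hy
  have e2 := log_int2 α y hα hy
  have : ∫ t in Ioi (0:ℝ), (-(Real.sin (Real.pi * α / 2)) * b - Real.cos (Real.pi * α / 2) * (Real.pi / 2)) * (t ^ α * Real.exp (-(y * t)))
        - Real.sin (Real.pi * α / 2) * (t ^ α * Real.log t * Real.exp (-(y * t))) =
      -Real.pi * (y ^ (-(α + 1)) * (cc α * (b - Real.log y) + cd α)) := by
    rw [integral_sub (i1.const_mul _) (i2.const_mul _), integral_const_mul, integral_const_mul, e1, e2]
    unfold cc cd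
    field_simp; ring
  rw [← this]
  apply setIntegral_congr_fun measurableSet_Ioi
  intro t (ht : 0 < t)
  simp only []
  have k1 : Ek y (Real.log t + (Real.pi / 2 : ℝ) * I) = (Real.exp (-(y * t)) : ℝ) := by
    unfold Ek
    rw [Complex.exp_add, ofReal_log ht.le, Complex.exp_log (by exact_mod_cast ht.ne')]
    push_cast
    rw [Complex.exp_pi_div_two_mul_I]
    congr 1
    linear_combination (y * t : ℂ) * I_sq
  have k2 : cexp ((Real.pi / 2 : ℝ) * I) * P2 α b (Real.log t + (Real.pi / 2 : ℝ) * I) =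
      ((t ^ α : ℝ) : ℂ) * (I * cexp ((Real.pi * α / 2 : ℝ) * I) * (((b + Real.log t : ℝ) : ℂ) + (Real.pi / 2 : ℝ) * I)) := by
    unfold P2
    rw [mul_add (α:ℂ), Complex.exp_add, cexp_rpow α t ht]
    push_cast
    rw [Complex.exp_pi_div_two_mul_I]
    rw [show (α:ℂ) * (Real.pi / 2 * I) = Real.pi * α / 2 * I by ring]
    ring
  rw [show ∀ a b c : ℂ, a * (b * c) = b * (a * c) by intros; ring, k1, k2, Complex.re_ofReal_mul, Complex.re_ofReal_mul]
  have k3 : (I * cexp ((Real.pi * α / 2 : ℝ) * I) * (((b + Real.log t : ℝ) : ℂ) + (Real.pi / 2 : ℝ) * I)).re =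
    -(Real.sin (Real.pi * α / 2)) * (b + Real.log t) - Real.cos (Real.pi * α / 2) * (Real.pi / 2) := by
    rw [Complex.exp_mul_I, ← ofReal_cos, ← ofReal_sin]
    simp only [mul_re, mul_im, add_re, add_im, I_re, I_im, ofReal_re, ofReal_im]; ring
  rw [k3]; ring

end

section

open Complex

def Wk (q α B t : ℝ) : ℝ := (t ^ 2 + q * t ^ α) * (t ^ α * (B + |Real.log t|))

lemma Wk_le (q α B t : ℝ) (hq : 0 ≤ q) (hα : 0 < α) (hB : 1 ≤ B) (ht : 0 < t) :
    Wk q α B t ≤ B * ((t ^ (α + 2) + t ^ (α + 3) + t ^ (α + 1)) +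
      q * (t ^ (2 * α) + (2 / α) * t ^ (5 / 2 * α) + (2 / α) * t ^ (3 / 2 * α))) := by
  have l1 := abs_log_le t 1 ht one_pos
  have l2 := abs_log_le t (α / 2) ht (by positivity)
  have a0 := abs_nonneg (Real.log t)
  have e1 : t ^ (α + 2) = t ^ α * t ^ 2 := by rw [Real.rpow_add ht]; norm_cast
  have e2 : t ^ (α + 3) = t ^ α * t ^ 3 := by rw [Real.rpow_add ht]; norm_cast
  have e3 : t ^ (α + 1) = t ^ α * t := by rw [Real.rpow_add ht]; norm_num
  have e4 : t ^ (2 * α) = t ^ α * t ^ α := by rw [← Real.rpow_add ht]; ring_nf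
  have e5 : t ^ (5 / 2 * α) = t ^ α * t ^ α * t ^ (α / 2) := by rw [← Real.rpow_add ht, ← Real.rpow_add ht]; ring_nf
  have e6 : t ^ (3 / 2 * α) = t ^ α * t ^ α * t ^ (-(α / 2)) := by rw [← Real.rpow_add ht, ← Real.rpow_add ht]; ring_nf
  rw [Real.rpow_one, Real.rpow_neg_one, div_one] at l1
  have b1 : B + |Real.log t| ≤ B * (1 + (t + t⁻¹)) := by nlinarith [show 0 < t + t⁻¹ by positivity]
  have b2 : B + |Real.log t| ≤ B * (1 + (t ^ (α / 2) + t ^ (-(α / 2))) / (α / 2)) := by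
    nlinarith [show 0 < (t ^ (α / 2) + t ^ (-(α / 2))) / (α / 2) by positivity]
  calc Wk q α B t = t ^ 2 * t ^ α * (B + |Real.log t|) + q * t ^ α * t ^ α * (B + |Real.log t|) := by unfold Wk; ring
    _ ≤ t ^ 2 * t ^ α * (B * (1 + (t + t⁻¹))) + q * t ^ α * t ^ α * (B * (1 + (t ^ (α / 2) + t ^ (-(α / 2))) / (α / 2))) := by gcongr
    _ = _ := by rw [e1, e2, e3, e4, e5, e6]; field_simp; ring

lemma ke_le (a p y s : ℝ) (ha : -1 < a) (hs : 0 < s) (hy : 1 ≤ y) (hp : p ≤ a + 1) :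
    ∫ t in Ioi (0:ℝ), t ^ a * Real.exp (-(y * s * t)) ≤ Real.Gamma (a + 1) * s ^ (-(a + 1)) * y ^ (-p) := by
  rw [ke_int a (y * s) ha (by positivity), Real.mul_rpow (by linarith) hs.le]
  have h1 : y ^ (-(a + 1)) ≤ y ^ (-p) := Real.rpow_le_rpow_of_exponent_le hy (by linarith)
  have := Real.Gamma_pos_of_pos (show 0 < a + 1 by linarith)
  calc _ = Real.Gamma (a + 1) * s ^ (-(a + 1)) * y ^ (-(a + 1)) := by ring
    _ ≤ _ := by gcongr

def Kg (a : ℝ) : ℝ := Real.Gamma (a + 1) * Real.sin psi ^ (-(a + 1))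
lemma Kg_pos (a : ℝ) (ha : -1 < a) : 0 < Kg a := by
  have := Real.Gamma_pos_of_pos (show 0 < a + 1 by linarith)
  have := psi_sin
  unfold Kg; positivity

def KE (α : ℝ) : ℝ := Kg (α + 2) + Kg (α + 3) + Kg (α + 1) + Kg (2 * α) + (2 / α) * Kg (5 / 2 * α) + (2 / α) * Kg (3 / 2 * α)

def Wmaj (q α B t : ℝ) : ℝ := B * ((t ^ (α + 2) + t ^ (α + 3) + t ^ (α + 1)) +
      q * (t ^ (2 * α) + (2 / α) * t ^ (5 / 2 * α) + (2 / α) * t ^ (3 / 2 * α)))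

lemma six (E1 E2 E3 E4 E5 E6 : ℝ → ℝ) (S : Set ℝ) (a q B : ℝ) (i1 : IntegrableOn E1 S) (i2 : IntegrableOn E2 S)
    (i3 : IntegrableOn E3 S) (i4 : IntegrableOn E4 S) (i5 : IntegrableOn E5 S) (i6 : IntegrableOn E6 S) :
    ∫ t in S, B * ((E1 t + E2 t + E3 t) + q * (E4 t + a * E5 t + a * E6 t)) =
     B * (((∫ t in S, E1 t) + (∫ t in S, E2 t) + ∫ t in S, E3 t) + q * ((∫ t in S, E4 t) + a * (∫ t in S, E5 t) + a * ∫ t in S, E6 t)) := by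
  have j5 : IntegrableOn (fun t => a * E5 t) S := i5.const_mul a
  have j6 : IntegrableOn (fun t => a * E6 t) S := i6.const_mul a
  have j12 : IntegrableOn (fun t => E1 t + E2 t) S := i1.add i2
  have j123 : IntegrableOn (fun t => E1 t + E2 t + E3 t) S := j12.add i3
  have j45 : IntegrableOn (fun t => E4 t + a * E5 t) S := i4.add j5
  have j456 : IntegrableOn (fun t => q * (E4 t + a * E5 t + a * E6 t)) S := (j45.add j6).const_mul q
  rw [integral_const_mul, integral_add j123 j456, integral_const_mul, integral_add j12 i3, integral_add i1 i2,
    integral_add j45 j6, integral_add i4 j5, integral_const_mul, integral_const_mul]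

lemma Wmaj_int (q α B y : ℝ) (hα : 0 < α) (hy : 1 ≤ y) :
    IntegrableOn (fun t => Wmaj q α B t * Real.exp (-(y * Real.sin psi * t))) (Ioi 0) ∧
    (0 ≤ q → 0 ≤ B → ∫ t in Ioi (0:ℝ), Wmaj q α B t * Real.exp (-(y * Real.sin psi * t)) ≤
      KE α * B * (y ^ (-(α + 1)) * (1 / y + q))) := by
  have hyp : 0 < y := by linarith
  have hc : 0 < y * Real.sin psi := mul_pos hyp psi_sin
  have i1 := (integrableOn_rpow_exp (a := α + 2) (c := y * Real.sin psi) (by linarith) hc)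
  have i2 := (integrableOn_rpow_exp (a := α + 3) (c := y * Real.sin psi) (by linarith) hc)
  have i3 := (integrableOn_rpow_exp (a := α + 1) (c := y * Real.sin psi) (by linarith) hc)
  have i4 := (integrableOn_rpow_exp (a := 2 * α) (c := y * Real.sin psi) (by linarith) hc)
  have i5 := (integrableOn_rpow_exp (a := 5 / 2 * α) (c := y * Real.sin psi) (by linarith) hc)
  have i6 := (integrableOn_rpow_exp (a := 3 / 2 * α) (c := y * Real.sin psi) (by linarith) hc)
  have hI := (((i1.add i2).add i3).add (((i4.add (i5.const_mul (2 / α))).add (i6.const_mul (2 / α))).const_mul q)).const_mul B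
  have he : (fun t => Wmaj q α B t * Real.exp (-(y * Real.sin psi * t))) = fun t =>
      B * (((t ^ (α + 2) * Real.exp (-(y * Real.sin psi * t)) + t ^ (α + 3) * Real.exp (-(y * Real.sin psi * t))) + t ^ (α + 1) * Real.exp (-(y * Real.sin psi * t)))
      + q * ((t ^ (2 * α) * Real.exp (-(y * Real.sin psi * t)) + (2 / α) * (t ^ (5 / 2 * α) * Real.exp (-(y * Real.sin psi * t)))) + (2 / α) * (t ^ (3 / 2 * α) * Real.exp (-(y * Real.sin psi * t))))) := by
    ext t; unfold Wmaj; ring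
  constructor
  · rw [he]; exact hI
  intro hq hB
  rw [he, six _ _ _ _ _ _ _ _ _ _ i1 i2 i3 i4 i5 i6]
  have b1 := ke_le (α + 2) (α + 2) y (Real.sin psi) (by linarith) psi_sin hy (by linarith)
  have b2 := ke_le (α + 3) (α + 2) y (Real.sin psi) (by linarith) psi_sin hy (by linarith)
  have b3 := ke_le (α + 1) (α + 2) y (Real.sin psi) (by linarith) psi_sin hy (by linarith)
  have b4 := ke_le (2 * α) (α + 1) y (Real.sin psi) (by linarith) psi_sin hy (by linarith)
  have b5 := ke_le (5 / 2 * α) (α + 1) y (Real.sin psi) (by linarith) psi_sin hy (by linarith)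
  have b6 := ke_le (3 / 2 * α) (α + 1) y (Real.sin psi) (by linarith) psi_sin hy (by linarith)
  have ey : y ^ (-(α + 2)) = y ^ (-(α + 1)) * (1 / y) := by
    rw [one_div, ← Real.rpow_neg_one, ← Real.rpow_add hyp]; ring_nf
  rw [ey] at b1 b2 b3
  set Y := y ^ (-(α + 1)) with hY
  have hYp : 0 < Y := Real.rpow_pos_of_pos hyp _
  have k1 := Kg_pos (α + 2) (by linarith)
  have k2 := Kg_pos (α + 3) (by linarith)
  have k3 := Kg_pos (α + 1) (by linarith)
  have k4 := Kg_pos (2 * α) (by linarith)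
  have k5 := Kg_pos (5 / 2 * α) (by linarith)
  have k6 := Kg_pos (3 / 2 * α) (by linarith)
  change _ ≤ Kg _ * _ at b1
  change _ ≤ Kg _ * _ at b2
  change _ ≤ Kg _ * _ at b3
  change _ ≤ Kg _ * _ at b4
  change _ ≤ Kg _ * _ at b5
  change _ ≤ Kg _ * _ at b6
  have hKE : Kg (α + 2) + Kg (α + 3) + Kg (α + 1) ≤ KE α := by
    unfold KE
    have : 0 ≤ Kg (2 * α) + (2 / α) * Kg (5 / 2 * α) + (2 / α) * Kg (3 / 2 * α) := by positivity
    linarith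
  have hKE2 : Kg (2 * α) + (2 / α) * Kg (5 / 2 * α) + (2 / α) * Kg (3 / 2 * α) ≤ KE α := by
    unfold KE
    linarith
  calc _ ≤ B * ((Kg (α + 2) * (Y * (1 / y)) + Kg (α + 3) * (Y * (1 / y)) + Kg (α + 1) * (Y * (1 / y)))
        + q * (Kg (2 * α) * Y + (2 / α) * (Kg (5 / 2 * α) * Y) + (2 / α) * (Kg (3 / 2 * α) * Y))) := by gcongr
    _ = B * ((Kg (α + 2) + Kg (α + 3) + Kg (α + 1)) * (Y * (1 / y)) +
        (Kg (2 * α) + (2 / α) * Kg (5 / 2 * α) + (2 / α) * Kg (3 / 2 * α)) * (q * Y)) := by ring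
    _ ≤ B * (KE α * (Y * (1 / y)) + KE α * (q * Y)) := by gcongr
    _ = _ := by ring

/-- comparison of ray integrals -/
lemma ray_diff (g1 g2 : ℂ → ℂ) (q α B c y : ℝ) (hq : 0 ≤ q) (hc : 0 ≤ c) (hα : 0 < α) (hB : 1 ≤ B) (hy : 1 ≤ y)
    (h1 : IntegrableOn (fun t : ℝ => Ek y (Real.log t + psi * I) * g1 (Real.log t + psi * I)) (Ioi 0))
    (h2 : IntegrableOn (fun t : ℝ => Ek y (Real.log t + psi * I) * g2 (Real.log t + psi * I)) (Ioi 0))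
    (hb : ∀ t : ℝ, 0 < t → ‖g1 (Real.log t + psi * I) - g2 (Real.log t + psi * I)‖ ≤ c * Wk q α B t) :
    |(ray psi (fun ζ => Ek y ζ * g1 ζ)).re - (ray psi (fun ζ => Ek y ζ * g2 ζ)).re| ≤
      c * (KE α * B * (y ^ (-(α + 1)) * (1 / y + q))) := by
  obtain ⟨i, hi⟩ := Wmaj_int q α B y hα hy
  have hi := hi hq (by linarith)
  rw [← Complex.sub_re]
  refine (Complex.abs_re_le_norm _).trans ?_
  unfold ray
  rw [← integral_sub (h1.const_mul _) (h2.const_mul _)]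
  refine le_trans (norm_integral_le_of_norm_le (i.const_mul c) ?_) (by rw [integral_const_mul]; gcongr)
  refine (ae_restrict_iff' measurableSet_Ioi).2 (Eventually.of_forall fun t (ht : 0 < t) => ?_)
  rw [← mul_sub, ← mul_sub, norm_mul, norm_mul, norm_Ek, Real.exp_log ht, Complex.norm_exp_ofReal_mul_I, one_mul, mul_comm]
  have := hb t ht
  have h3 := Wk_le q α B t hq hα hB ht
  calc _ ≤ (c * Wk q α B t) * Real.exp (-(y * Real.sin psi * t)) := by gcongr
    _ ≤ (c * Wmaj q α B t) * Real.exp (-(y * Real.sin psi * t)) := by gcongr; exact h3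
    _ = _ := by ring

lemma psi_pi8 : psi ≤ Real.pi / 8 := le_rfl

lemma A_sub (t : ℝ) (ht : 0 < t) : ‖Ak (Real.log t + psi * I) - 1‖ ≤ t ^ 2 := by
  unfold Ak
  refine (exp_neg_bd1 _ ?_).trans ?_
  · rw [Ak_re]
    have := cos2_ge psi psi_pos.le psi_pi8
    have : 0 ≤ Real.cos (2 * psi) := by linarith
    positivity
  · rw [Ak_norm', Real.exp_log ht]; nlinarith [sq_nonneg t]

lemma G2_sub (q α b t : ℝ) (hq : 0 ≤ q) (hα : 0 < α) (hα2 : α < 2) (ht : 0 < t) :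
    ‖G2 q α b (Real.log t + psi * I) - P2 α b (Real.log t + psi * I)‖ ≤ 1 * Wk q α (|b| + 2) t := by
  have hX := Xk_re q α (Real.log t) psi hq hα.le hα2.le psi_pos.le psi_pi8
  have hXn := Xk_norm q α (Real.log t) psi hq
  have h1 := exp_neg_bd1 _ hX
  have hA := norm_Ak_le1 (Real.log t) psi psi_pos.le psi_pi8
  have hA2 := A_sub t ht
  have hP := norm_P2_le α b (Real.log t) psi psi_pos.le (by unfold psi; linarith [Real.pi_pos])
  rw [Real.exp_log ht] at hXn hP
  rw [hXn] at h1
  unfold G2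
  set ζ : ℂ := Real.log t + psi * I
  rw [show Ak ζ * cexp (-Xk q α ζ) * P2 α b ζ - P2 α b ζ = (Ak ζ * (cexp (-Xk q α ζ) - 1) + (Ak ζ - 1)) * P2 α b ζ by ring,
    norm_mul, one_mul, Wk]
  have : ‖Ak ζ * (cexp (-Xk q α ζ) - 1) + (Ak ζ - 1)‖ ≤ t ^ 2 + q * t ^ α := by
    refine (norm_add_le _ _).trans ?_
    rw [norm_mul]
    nlinarith [norm_nonneg (cexp (-Xk q α ζ) - 1)]
  gcongr

lemma G1_sub (q α t : ℝ) (hq : 0 ≤ q) (hα : 0 < α) (hα2 : α < 2) (ht : 0 < t) :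
    ‖G1 q α (Real.log t + psi * I) - (-(Xk q α (Real.log t + psi * I)))‖ ≤ q * Wk q α 2 t := by
  have hX := Xk_re q α (Real.log t) psi hq hα.le hα2.le psi_pos.le psi_pi8
  have hXn := Xk_norm q α (Real.log t) psi hq
  have h1 := exp_neg_bd2 _ hX
  have hA := norm_Ak_le1 (Real.log t) psi psi_pos.le psi_pi8
  have hA2 := A_sub t ht
  rw [Real.exp_log ht] at hXn
  rw [hXn] at h1
  unfold G1
  set ζ : ℂ := Real.log t + psi * I
  rw [show Ak ζ * (cexp (-Xk q α ζ) - 1) - (-(Xk q α ζ)) = (Ak ζ * (cexp (-Xk q α ζ) - 1 + Xk q α ζ) - (Ak ζ - 1) * Xk q α ζ) by ring]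
  have hp : 0 < t ^ α := by positivity
  have a0 := abs_nonneg (Real.log t)
  calc _ ≤ ‖Ak ζ‖ * ‖cexp (-Xk q α ζ) - 1 + Xk q α ζ‖ + ‖Ak ζ - 1‖ * ‖Xk q α ζ‖ := by
        refine (norm_sub_le _ _).trans ?_
        rw [norm_mul, norm_mul]
    _ ≤ 1 * (q * t ^ α) ^ 2 + t ^ 2 * (q * t ^ α) := by rw [hXn]; gcongr
    _ = q * ((t ^ 2 + q * t ^ α) * (t ^ α * 1)) := by ring
    _ ≤ _ := by unfold Wk; gcongr; linarith

lemma dL_asymp (q α b y : ℝ) (hq : 0 ≤ q) (hα : 0 < α) (hα2 : α < 2) (hy : 1 ≤ y) :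
    |dL q α b y + y ^ (-(α + 1)) * (cc α * (b - Real.log y) + cd α)| ≤
      2 * KE α * (1 + |b|) * (y ^ (-(α + 1)) * (1 / y + q)) := by
  have hyp : 0 < y := by linarith
  have hψ : psi ≤ Real.pi / 2 := by unfold psi; linarith [Real.pi_pos]
  have i1 := ray_integrable _ ((Ek_diff y).mul (G2_diff q α b)) _ 1 psi one_pos
    (fun s => bound_EG2 q α b y s psi hq hα hα2 hyp.le psi_pos.le psi_pi8)
  have i2 := ray_integrable _ ((Ek_diff y).mul (P2_diff α b)) _ (y * Real.sin psi) psi (mul_pos hyp psi_sin)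
    (fun s => bound_EP2 α b y s psi psi hα hα2 hyp psi_pos.le le_rfl hψ)
  have h := ray_diff (G2 q α b) (P2 α b) q α (|b| + 2) 1 y hq zero_le_one hα (by linarith [abs_nonneg b]) hy i1 i2
    (fun t ht => G2_sub q α b t hq hα hα2 ht)
  rw [P2_ray α b y hα hα2 hyp] at h
  rw [dL_ray q α b y hq hα hα2 hyp.le]
  set R := (ray psi fun ζ => Ek y ζ * G2 q α b ζ).re
  set Z := y ^ (-(α + 1)) * (cc α * (b - Real.log y) + cd α)
  have e : Real.pi⁻¹ * R + Z = Real.pi⁻¹ * (R - -Real.pi * Z) := by field_simp; ring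
  have hpi : Real.pi⁻¹ ≤ 1 := inv_le_one_of_one_le₀ (by linarith [Real.pi_gt_three])
  have hpi0 : 0 < Real.pi⁻¹ := by positivity
  have hK : 0 ≤ KE α := by
    have k1 := Kg_pos (α + 2) (by linarith)
    have k2 := Kg_pos (α + 3) (by linarith)
    have k3 := Kg_pos (α + 1) (by linarith)
    have k4 := Kg_pos (2 * α) (by linarith)
    have k5 := Kg_pos (5 / 2 * α) (by linarith)
    have k6 := Kg_pos (3 / 2 * α) (by linarith)
    unfold KE; positivity
  rw [e, abs_mul, abs_of_pos hpi0]
  calc _ ≤ 1 * (1 * (KE α * (|b| + 2) * (y ^ (-(α + 1)) * (1 / y + q)))) := by gcongr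
    _ ≤ 1 * (1 * (KE α * (2 * (1 + |b|)) * (y ^ (-(α + 1)) * (1 / y + q)))) := by
      gcongr; linarith [abs_nonneg b]
    _ = _ := by ring

lemma KE_nonneg (α : ℝ) (hα : 0 < α) : 0 ≤ KE α := by
  have k1 := Kg_pos (α + 2) (by linarith)
  have k2 := Kg_pos (α + 3) (by linarith)
  have k3 := Kg_pos (α + 1) (by linarith)
  have k4 := Kg_pos (2 * α) (by linarith)
  have k5 := Kg_pos (5 / 2 * α) (by linarith)
  have k6 := Kg_pos (3 / 2 * α) (by linarith)
  unfold KE; positivity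

lemma dF_asymp (q α y : ℝ) (hq : 0 ≤ q) (hα : 0 < α) (hα2 : α < 2) (hy : 1 ≤ y) :
    |dF q α y - q * cc α * y ^ (-(α + 1))| ≤
      2 * KE α * q * (y ^ (-(α + 1)) * (1 / y + q)) := by
  have hyp : 0 < y := by linarith
  have hψ : psi ≤ Real.pi / 2 := by unfold psi; linarith [Real.pi_pos]
  have i1 := ray_integrable _ ((Ek_diff y).mul (G1_diff q α)) _ 1 psi one_pos
    (fun s => bound_EG1 q α y s psi hq hα hα2 hyp.le psi_pos.le psi_pi8)
  have i20 : IntegrableOn (fun t : ℝ => Ek y (Real.log t + psi * I) * P2 α 0 (Real.log t + psi * I)) (Ioi 0) := ray_integrable _ ((Ek_diff y).mul (P2_diff α 0)) _ (y * Real.sin psi) psi (mul_pos hyp psi_sin)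
    (fun s => bound_EP2 α 0 y s psi psi hα hα2 hyp psi_pos.le le_rfl hψ)
  have i21 : IntegrableOn (fun t : ℝ => Ek y (Real.log t + psi * I) * P2 α 1 (Real.log t + psi * I)) (Ioi 0) := ray_integrable _ ((Ek_diff y).mul (P2_diff α 1)) _ (y * Real.sin psi) psi (mul_pos hyp psi_sin)
    (fun s => bound_EP2 α 1 y s psi psi hα hα2 hyp psi_pos.le le_rfl hψ)
  have eX : ∀ ζ : ℂ, Ek y ζ * (-(Xk q α ζ)) = (q : ℂ) * (Ek y ζ * P2 α 0 ζ - Ek y ζ * P2 α 1 ζ) := by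
    intro ζ; unfold Xk P2; push_cast; ring
  have i2 : IntegrableOn (fun t : ℝ => Ek y (Real.log t + psi * I) * (fun ζ => -(Xk q α ζ)) (Real.log t + psi * I)) (Ioi 0) := by
    simp only [eX]
    exact (i20.sub i21).const_mul (q:ℂ)
  have hray : (ray psi (fun ζ => Ek y ζ * (fun ζ => -(Xk q α ζ)) ζ)).re = Real.pi * (q * cc α * y ^ (-(α + 1))) := by
    have p0 := P2_ray α 0 y hα hα2 hyp
    have p1 := P2_ray α 1 y hα hα2 hyp
    have : ray psi (fun ζ => Ek y ζ * (fun ζ => -(Xk q α ζ)) ζ) =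
        (q:ℂ) * (ray psi (fun ζ => Ek y ζ * P2 α 0 ζ) - ray psi (fun ζ => Ek y ζ * P2 α 1 ζ)) := by
      simp only [eX]
      unfold ray
      rw [← integral_sub (i20.const_mul _) (i21.const_mul _), ← integral_const_mul]
      congr 1; ext t; ring
    rw [this, Complex.re_ofReal_mul, Complex.sub_re, p0, p1]; ring
  have h := ray_diff (G1 q α) (fun ζ => -(Xk q α ζ)) q α 2 q y hq hq hα (by norm_num) hy i1 i2
    (fun t ht => G1_sub q α t hq hα hα2 ht)
  rw [hray] at h
  rw [dF_ray q α y hq hα hα2 hyp.le]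
  set R := (ray psi fun ζ => Ek y ζ * G1 q α ζ).re
  set Z := q * cc α * y ^ (-(α + 1))
  have e : Real.pi⁻¹ * R - Z = Real.pi⁻¹ * (R - Real.pi * Z) := by field_simp
  have hpi : Real.pi⁻¹ ≤ 1 := inv_le_one_of_one_le₀ (by linarith [Real.pi_gt_three])
  have hpi0 : 0 < Real.pi⁻¹ := by positivity
  have hK := KE_nonneg α hα
  rw [e, abs_mul, abs_of_pos hpi0]
  calc _ ≤ 1 * (q * (KE α * 2 * (y ^ (-(α + 1)) * (1 / y + q)))) := by gcongr
    _ = _ := by ring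

end

section

lemma quot_pt (l L f c Λ ε K H C1 : ℝ) (hc : 0 < c) (hf : c / 2 ≤ f) (hl : |l - L| ≤ K * Λ * ε)
    (hfc : |f - c| ≤ H * ε) (hL : |L| ≤ C1 * Λ) (he : 0 ≤ ε) (he2 : ε ≤ 2) (hΛ : 0 ≤ Λ) (hK : 0 ≤ K)
    (hH : 0 ≤ H) (hC1 : 0 ≤ C1) :
    |l ^ 2 / f - L ^ 2 / c| ≤ (2 * K * (2 * C1 + 2 * K) / c + 2 * C1 ^ 2 * H / c ^ 2) * (Λ ^ 2 * ε) := by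
  have hfp : 0 < f := by linarith
  have e : l ^ 2 / f - L ^ 2 / c = (l - L) * (l + L) / f - L ^ 2 * (f - c) / (f * c) := by
    field_simp; ring
  have h1 : |l + L| ≤ (2 * C1 + 2 * K) * Λ := by
    have : l + L = (l - L) + 2 * L := by ring
    rw [this]
    refine (abs_add_le _ _).trans ?_
    rw [abs_mul, abs_of_pos (by norm_num : (0:ℝ) < 2)]
    nlinarith [mul_nonneg hK hΛ]
  have h2 : |(l - L) * (l + L) / f| ≤ (K * Λ * ε) * ((2 * C1 + 2 * K) * Λ) / (c / 2) := by
    rw [abs_div, abs_mul, abs_of_pos hfp]; gcongr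
  have h3 : |L ^ 2 * (f - c) / (f * c)| ≤ (C1 * Λ) ^ 2 * (H * ε) / (c / 2 * c) := by
    rw [abs_div, abs_mul, abs_pow, abs_of_pos (mul_pos hfp hc)]; gcongr
  rw [e]
  refine (abs_sub _ _).trans ((add_le_add h2 h3).trans (le_of_eq ?_))
  field_simp

structure Ctx (α c c' K q b : ℝ) (d l : ℝ → ℝ) : Prop where
  hα : 0 < α
  hα2 : α < 2
  hc : 0 < c
  hK : 0 ≤ K
  hq : 0 < q
  hq1 : q ≤ 1
  hd : ∀ y, 1 ≤ y → |d y - q * c * y ^ (-(α + 1))| ≤ K * q * (y ^ (-(α + 1)) * (1 / y + q))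
  hl : ∀ y, 1 ≤ y → |l y - q * (y ^ (-(α + 1)) * (c * (b - Real.log y) + c'))| ≤
    K * q * (1 + |b|) * (y ^ (-(α + 1)) * (1 / y + q))
  hd0 : ∀ y, |d y| ≤ K * q
  hl0 : ∀ y, |l y| ≤ K * q * (1 + |b|)
  hdc : Continuous d
  hlc : Continuous l

namespace Ctx
variable {α c c' K q b : ℝ} {d l : ℝ → ℝ}

/-- general quotient comparison at a point, with gaussian term controlled by `G` -/
lemma pt (h : Ctx α c c' K q b d l) (y G : ℝ) (hG0 : 0 ≤ G) (hy : 1 ≤ y)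
    (hK : K * (1 / y + q) ≤ c / 2) (hG : gauss y ≤ G * q * (y ^ (-(α + 1)) * (1 / y + q))) :
    |l y ^ 2 / (gauss y + d y) - q / c * (y ^ (-(α + 1)) * (c * (b - Real.log y) + c') ^ 2)| ≤
     (2 * K * (2 * (c + |c'|) + 2 * K) / c + 2 * (c + |c'|) ^ 2 * (G + K) / c ^ 2) *
      (q * y ^ (-(α + 1)) * (1 + |b| + Real.log y) ^ 2 * (1 / y + q)) := by
  have hyp : 0 < y := by linarith
  have hlog := Real.log_nonneg hy
  have hb := abs_nonneg b
  have hc := h.hc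
  have hq := h.hq
  have hK0 := h.hK
  have hd := h.hd y hy
  have hl := h.hl y hy
  have hq1 := h.hq1
  set Y := y ^ (-(α + 1)) with hYd
  have hY : 0 < Y := Real.rpow_pos_of_pos hyp _
  have hiy : 1 / y ≤ 1 := by rw [div_le_one hyp]; exact hy
  have hiy0 : 0 < 1 / y := by positivity
  set ε := 1 / y + q with hε
  have hg := (gauss_pos y).le
  set L := c * (b - Real.log y) + c'
  have hqY : 0 < q * Y := by positivity
  have hL : |L| ≤ (c + |c'|) * (1 + |b| + Real.log y) := by
    refine (abs_add_le _ _).trans ?_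
    rw [abs_mul, abs_of_pos hc]
    have h1 : |b - Real.log y| ≤ |b| + Real.log y := by
      refine (abs_sub _ _).trans ?_; rw [abs_of_nonneg hlog]
    have := abs_nonneg c'
    nlinarith [mul_le_mul_of_nonneg_left h1 hc.le, mul_nonneg this hb, mul_nonneg this hlog]
  have hlow : c / 2 ≤ (gauss y + d y) / (q * Y) := by
    rw [le_div_iff₀ hqY]
    have := (abs_le.1 hd).1
    nlinarith
  have key := quot_pt (l y / (q * Y)) L ((gauss y + d y) / (q * Y)) c (1 + |b| + Real.log y) ε K (G + K) (c + |c'|) hc hlow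
    (by
      rw [show l y / (q * Y) - L = (l y - q * (Y * L)) / (q * Y) by field_simp, abs_div, abs_of_pos hqY, div_le_iff₀ hqY]
      refine hl.trans ?_
      have : K * q * (1 + |b|) * (Y * ε) ≤ K * q * (1 + |b| + Real.log y) * (Y * ε) := by
        have hbb : 1 + |b| ≤ 1 + |b| + Real.log y := by linarith
        exact mul_le_mul_of_nonneg_right (mul_le_mul_of_nonneg_left hbb (by positivity)) (by positivity)
      linarith)
    (by
      rw [show (gauss y + d y) / (q * Y) - c = (gauss y + (d y - q * c * Y)) / (q * Y) by field_simp; ring, abs_div, abs_of_pos hqY, div_le_iff₀ hqY]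
      refine (abs_add_le _ _).trans ?_
      rw [abs_of_nonneg hg]
      linarith)
    hL (by positivity) (by linarith) (by positivity) hK0 (by positivity) (by positivity)
  have hf : 0 < gauss y + d y := by
    have : 0 < (gauss y + d y) / (q * Y) := by linarith
    exact (div_pos_iff_of_pos_right hqY).1 this
  have e : l y ^ 2 / (gauss y + d y) - q / c * (Y * L ^ 2) =
      (q * Y) * ((l y / (q * Y)) ^ 2 / ((gauss y + d y) / (q * Y)) - L ^ 2 / c) := by
    field_simp
  rw [e, abs_mul, abs_of_pos hqY]
  calc _ ≤ (q * Y) * _ := mul_le_mul_of_nonneg_left key hqY.le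
    _ = _ := by ring

/-- the two upper bounds on l²/f -/
lemma up (h : Ctx α c c' K q b d l) (y : ℝ) (hy : 1 ≤ y) (hK : K * (1 / y + q) ≤ c / 2) :
    0 < gauss y + d y ∧
    l y ^ 2 / (gauss y + d y) ≤ 2 * (c + |c'| + 2 * K) ^ 2 / c * (q * y ^ (-(α + 1)) * (1 + |b| + Real.log y) ^ 2) ∧
    l y ^ 2 / (gauss y + d y) ≤ (c + |c'| + 2 * K) ^ 2 * (q ^ 2 * (1 + |b| + Real.log y) ^ 2) / gauss y := by
  have hyp : 0 < y := by linarith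
  have hlog := Real.log_nonneg hy
  have hb := abs_nonneg b
  have hc := h.hc
  have hq := h.hq
  have hK0 := h.hK
  have hd := h.hd y hy
  have hl := h.hl y hy
  have hq1 := h.hq1
  have hY1 : y ^ (-(α + 1)) ≤ 1 := Real.rpow_le_one_of_one_le_of_nonpos hy (by linarith [h.hα])
  set Y := y ^ (-(α + 1)) with hYd
  have hY : 0 < Y := Real.rpow_pos_of_pos hyp _
  have hiy : 1 / y ≤ 1 := by rw [div_le_one hyp]; exact hy
  have hiy0 : 0 < 1 / y := by positivity
  set ε := 1 / y + q with hε
  have hg := (gauss_pos y)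
  set L := c * (b - Real.log y) + c'
  have hqY : 0 < q * Y := by positivity
  have hL : |L| ≤ (c + |c'|) * (1 + |b| + Real.log y) := by
    refine (abs_add_le _ _).trans ?_
    rw [abs_mul, abs_of_pos hc]
    have h1 : |b - Real.log y| ≤ |b| + Real.log y := by
      refine (abs_sub _ _).trans ?_; rw [abs_of_nonneg hlog]
    have := abs_nonneg c'
    nlinarith [mul_le_mul_of_nonneg_left h1 hc.le, mul_nonneg this hb, mul_nonneg this hlog]
  have hdlow : c / 2 * (q * Y) ≤ d y := by
    have := (abs_le.1 hd).1
    nlinarith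
  have hlup : |l y| ≤ (c + |c'| + 2 * K) * (q * Y * (1 + |b| + Real.log y)) := by
    have e : l y = (l y - q * (Y * L)) + q * Y * L := by ring
    rw [e]
    refine (abs_add_le _ _).trans ?_
    rw [abs_mul (q * Y), abs_of_pos hqY]
    have h1 : K * q * (1 + |b|) * (Y * ε) ≤ K * q * (1 + |b| + Real.log y) * (Y * 2) := by
      have hbb : 1 + |b| ≤ 1 + |b| + Real.log y := by linarith
      have hee : ε ≤ 2 := by linarith
      exact mul_le_mul (mul_le_mul_of_nonneg_left hbb (by positivity)) (mul_le_mul_of_nonneg_left hee hY.le)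
        (by positivity) (by positivity)
    have h2 := mul_le_mul_of_nonneg_left hL hqY.le
    linarith
  have hsq : l y ^ 2 ≤ ((c + |c'| + 2 * K) * (q * Y * (1 + |b| + Real.log y))) ^ 2 := by
    rw [← sq_abs]; gcongr
  have hdp : 0 < d y := lt_of_lt_of_le (by positivity) hdlow
  refine ⟨by linarith, ?_, ?_⟩
  · calc l y ^ 2 / (gauss y + d y) ≤ ((c + |c'| + 2 * K) * (q * Y * (1 + |b| + Real.log y))) ^ 2 / (c / 2 * (q * Y)) := by
          gcongr; linarith
      _ = _ := by field_simp
  · calc l y ^ 2 / (gauss y + d y) ≤ ((c + |c'| + 2 * K) * (q * 1 * (1 + |b| + Real.log y))) ^ 2 / gauss y := by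
          refine div_le_div₀ (by positivity) (hsq.trans ?_) hg (by linarith)
          gcongr
      _ = _ := by ring

end Ctx

end

section

def mainT (α c c' q b y : ℝ) : ℝ := q / c * (y ^ (-(α + 1)) * (c * (b - Real.log y) + c') ^ 2)

lemma rpow_exp_bd (x a : ℝ) (hx : 1 ≤ x) (ha : a ≤ 4) : x ^ a * Real.exp (-x) ≤ 24 := by
  have h1 : x ^ a ≤ x ^ (4:ℝ) := Real.rpow_le_rpow_of_exponent_le hx ha
  rw [show x ^ (4:ℝ) = x ^ (4:ℕ) by exact_mod_cast Real.rpow_natCast x 4] at h1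
  have h2 := Real.pow_div_factorial_le_exp x (by linarith) 4
  have h3 : ((4:ℕ).factorial : ℝ) = 24 := by norm_num [Nat.factorial]
  rw [h3, div_le_iff₀ (by norm_num)] at h2
  have h4 : Real.exp x * Real.exp (-x) = 1 := by rw [← Real.exp_add]; simp
  calc _ ≤ (Real.exp x * 24) * Real.exp (-x) := by gcongr; linarith
    _ = 24 * (Real.exp x * Real.exp (-x)) := by ring
    _ = 24 := by rw [h4]; ring

namespace Ctx
variable {α c c' K q b : ℝ} {d l : ℝ → ℝ}

structure Big (c K A Y0 q M : ℝ) : Prop where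
  hA : 0 < A
  hqM : q = A * Real.exp (-(M ^ 2) / 2)
  hM : 2 ≤ M
  hY0 : 1 ≤ Y0
  hYM : Y0 ≤ M - 1
  hKY : K * (1 / Y0) ≤ c / 4
  hKq : K * q ≤ c / 4
  hKg : K * q ≤ gauss Y0 / 2

lemma Big.qe {A Y0 M : ℝ} (B : Big c K A Y0 q M) : q ≤ A * Real.exp (1 / 2) * Real.exp (-M) := by
  rw [B.hqM, mul_assoc, ← Real.exp_add]
  apply mul_le_mul_of_nonneg_left _ B.hA.le
  apply Real.exp_le_exp.2; nlinarith [sq_nonneg (M - 1)]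

lemma Big.hKε {A Y0 M : ℝ} (B : Big c K A Y0 q M) (hK : 0 ≤ K) (y : ℝ) (hy : Y0 ≤ y) : K * (1 / y + q) ≤ c / 2 := by
  have h1 := B.hKY; have h2 := B.hKq
  have h3 : 1 / y ≤ 1 / Y0 := one_div_le_one_div_of_le (by linarith [B.hY0]) hy
  nlinarith [mul_le_mul_of_nonneg_left h3 hK]

def CA (c c' K A Y0 : ℝ) : ℝ := 2 * K ^ 2 * (A * Real.exp (1 / 2)) / gauss Y0 +
  (c + |c'| + 2 * K) ^ 2 * (Real.sqrt (2 * Real.pi) * (A * Real.exp (1 / 2)))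

lemma regAB {A Y0 M : ℝ} (h : Ctx α c c' K q b d l) (B : Big c K A Y0 q M) (y : ℝ) (hy0 : 0 < y) (hy : y ≤ M - 1) :
    |l y ^ 2 / (gauss y + d y)| ≤ CA c c' K A Y0 * (q * (1 + |b| + Real.log M) ^ 2 * Real.exp (-M)) := by
  have hb := abs_nonneg b
  have hM := B.hM
  have hlM := Real.log_nonneg (show (1:ℝ) ≤ M by linarith)
  have hq := h.hq
  have hA := B.hA
  have hK := h.hK
  have hc := h.hc
  have hc' := abs_nonneg c'
  have hqe := B.qe
  have hg0 := gauss_pos Y0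
  have hs : 0 < Real.sqrt (2 * Real.pi) := Real.sqrt_pos.2 (by positivity)
  rcases le_total y Y0 with hy1 | hy1
  · have h1 : gauss Y0 ≤ gauss y := by
      unfold gauss
      have : y ^ 2 ≤ Y0 ^ 2 := by gcongr
      gcongr
    have h2 : gauss Y0 / 2 ≤ gauss y + d y := by
      have := (abs_le.1 (h.hd0 y)).1
      linarith [B.hKg]
    have hf : 0 < gauss y + d y := by linarith
    rw [abs_of_nonneg (by positivity)]
    have h3 : l y ^ 2 ≤ (K * q * (1 + |b| + Real.log M)) ^ 2 := by
      rw [← sq_abs]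
      have := h.hl0 y
      have hbb : 1 + |b| ≤ 1 + |b| + Real.log M := by linarith
      have := this.trans (mul_le_mul_of_nonneg_left hbb (by positivity : 0 ≤ K * q))
      gcongr
    calc _ ≤ (K * q * (1 + |b| + Real.log M)) ^ 2 / (gauss Y0 / 2) := by gcongr
      _ = 2 * K ^ 2 / gauss Y0 * (1 + |b| + Real.log M) ^ 2 * q * q := by field_simp
      _ ≤ 2 * K ^ 2 / gauss Y0 * (1 + |b| + Real.log M) ^ 2 * q * (A * Real.exp (1 / 2) * Real.exp (-M)) := by gcongr
      _ = (2 * K ^ 2 * (A * Real.exp (1 / 2)) / gauss Y0) * (q * (1 + |b| + Real.log M) ^ 2 * Real.exp (-M)) := by ring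
      _ ≤ _ := by
        unfold CA
        apply mul_le_mul_of_nonneg_right _ (by positivity)
        have : 0 ≤ (c + |c'| + 2 * K) ^ 2 * (Real.sqrt (2 * Real.pi) * (A * Real.exp (1 / 2))) := by positivity
        linarith
  · have hy1' : 1 ≤ y := by linarith [B.hY0]
    obtain ⟨hf, _, h2⟩ := h.up y hy1' (B.hKε hK y hy1)
    have hly := Real.log_nonneg hy1'
    have hlyM : Real.log y ≤ Real.log M := Real.log_le_log (by linarith) (by linarith)
    rw [abs_of_nonneg (by positivity)]
    have hgq : q / gauss y ≤ Real.sqrt (2 * Real.pi) * (A * Real.exp (1 / 2)) * Real.exp (-M) := by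
      rw [div_le_iff₀ (gauss_pos y)]
      unfold gauss
      rw [B.hqM]
      rw [show Real.sqrt (2 * Real.pi) * (A * Real.exp (1 / 2)) * Real.exp (-M) * ((Real.sqrt (2 * Real.pi))⁻¹ * Real.exp (-(y ^ 2) / 2))
        = (Real.sqrt (2 * Real.pi) * (Real.sqrt (2 * Real.pi))⁻¹) * (A * (Real.exp (1 / 2) * Real.exp (-M) * Real.exp (-(y ^ 2) / 2))) by ring,
        mul_inv_cancel₀ hs.ne', one_mul, ← Real.exp_add, ← Real.exp_add]
      apply mul_le_mul_of_nonneg_left _ hA.le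
      apply Real.exp_le_exp.2
      nlinarith
    have hgp := gauss_pos y
    calc _ ≤ _ := h2
      _ = (c + |c'| + 2 * K) ^ 2 * q * (1 + |b| + Real.log y) ^ 2 * (q / gauss y) := by ring
      _ ≤ (c + |c'| + 2 * K) ^ 2 * q * (1 + |b| + Real.log M) ^ 2 * (Real.sqrt (2 * Real.pi) * (A * Real.exp (1 / 2)) * Real.exp (-M)) := by
        gcongr
      _ = ((c + |c'| + 2 * K) ^ 2 * (Real.sqrt (2 * Real.pi) * (A * Real.exp (1 / 2)))) * (q * (1 + |b| + Real.log M) ^ 2 * Real.exp (-M)) := by ring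
      _ ≤ _ := by
        unfold CA
        apply mul_le_mul_of_nonneg_right _ (by positivity)
        have : 0 ≤ 2 * K ^ 2 * (A * Real.exp (1 / 2)) / gauss Y0 := by positivity
        linarith

lemma main_up (h : Ctx α c c' K q b d l) (y : ℝ) (hy : 1 ≤ y) :
    |mainT α c c' q b y| ≤ (c + |c'|) ^ 2 / c * (q * y ^ (-(α + 1)) * (1 + |b| + Real.log y) ^ 2) := by
  have hyp : 0 < y := by linarith
  have hlog := Real.log_nonneg hy
  have hb := abs_nonneg b
  have hc := h.hc
  have hq := h.hq
  have hL : |c * (b - Real.log y) + c'| ≤ (c + |c'|) * (1 + |b| + Real.log y) := by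
    refine (abs_add_le _ _).trans ?_
    rw [abs_mul, abs_of_pos hc]
    have h1 : |b - Real.log y| ≤ |b| + Real.log y := by
      refine (abs_sub _ _).trans ?_; rw [abs_of_nonneg hlog]
    have := abs_nonneg c'
    nlinarith [mul_le_mul_of_nonneg_left h1 hc.le, mul_nonneg this hb, mul_nonneg this hlog]
  unfold mainT
  rw [abs_of_nonneg (by positivity), ← sq_abs]
  calc _ ≤ q / c * (y ^ (-(α + 1)) * ((c + |c'|) * (1 + |b| + Real.log y)) ^ 2) := by gcongr
    _ = _ := by ring

lemma regC {A Y0 M : ℝ} (h : Ctx α c c' K q b d l) (B : Big c K A Y0 q M) (y : ℝ) (hy0 : M - 1 ≤ y) (hy : y ≤ M + 1) :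
    |l y ^ 2 / (gauss y + d y) - (Ioi M).indicator (mainT α c c' q b) y| ≤
      32 * (2 * (c + |c'| + 2 * K) ^ 2 / c + (c + |c'|) ^ 2 / c) * (q * (1 + |b| + Real.log M) ^ 2 * M ^ (-(α + 1))) := by
  have hM := B.hM
  have hy1 : 1 ≤ y := by linarith
  have hyp : 0 < y := by linarith
  have hq := h.hq
  have hc := h.hc
  have hK := h.hK
  have hα := h.hα
  have hα2 := h.hα2
  have hb := abs_nonneg b
  have hlM := Real.log_nonneg (show (1:ℝ) ≤ M by linarith)
  have hly := Real.log_nonneg hy1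
  obtain ⟨hf, h1, _⟩ := h.up y hy1 (B.hKε h.hK y (by linarith [B.hYM]))
  have h2 := h.main_up y hy1
  have h3 : |(Ioi M).indicator (mainT α c c' q b) y| ≤ |mainT α c c' q b y| := by
    by_cases hh : y ∈ Ioi M
    · rw [indicator_of_mem hh]
    · rw [indicator_of_notMem hh, abs_zero]; exact abs_nonneg _
  have hY : y ^ (-(α + 1)) ≤ 8 * M ^ (-(α + 1)) := by
    have a1 : y ^ (-(α + 1)) ≤ (M / 2) ^ (-(α + 1)) :=
      Real.rpow_le_rpow_of_nonpos (by linarith) (by linarith) (by linarith)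
    rw [Real.div_rpow (by linarith) (by norm_num), Real.rpow_neg (by norm_num : (0:ℝ) ≤ 2), div_inv_eq_mul] at a1
    have a2 : (2:ℝ) ^ (α + 1) ≤ 2 ^ (3:ℝ) := Real.rpow_le_rpow_of_exponent_le (by norm_num) (by linarith)
    rw [show (2:ℝ) ^ (3:ℝ) = 8 by norm_num] at a2
    have a3 : 0 < M ^ (-(α + 1)) := Real.rpow_pos_of_pos (by linarith) _
    nlinarith
  have hΛ : 1 + |b| + Real.log y ≤ 2 * (1 + |b| + Real.log M) := by
    have a1 : Real.log y ≤ Real.log (2 * M) := Real.log_le_log hyp (by linarith)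
    rw [Real.log_mul (by norm_num) (by linarith)] at a1
    have := Real.log_two_lt_d9
    linarith
  refine (abs_sub _ _).trans ?_
  rw [abs_of_nonneg (div_nonneg (sq_nonneg _) hf.le)]
  have hMp : 0 < M ^ (-(α + 1)) := Real.rpow_pos_of_pos (by linarith) _
  calc _ ≤ 2 * (c + |c'| + 2 * K) ^ 2 / c * (q * y ^ (-(α + 1)) * (1 + |b| + Real.log y) ^ 2) +
        (c + |c'|) ^ 2 / c * (q * y ^ (-(α + 1)) * (1 + |b| + Real.log y) ^ 2) := by linarith
    _ = (2 * (c + |c'| + 2 * K) ^ 2 / c + (c + |c'|) ^ 2 / c) * (q * y ^ (-(α + 1)) * (1 + |b| + Real.log y) ^ 2) := by ring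
    _ ≤ (2 * (c + |c'| + 2 * K) ^ 2 / c + (c + |c'|) ^ 2 / c) * (q * (8 * M ^ (-(α + 1))) * (2 * (1 + |b| + Real.log M)) ^ 2) := by gcongr
    _ = _ := by ring

def CD (α c c' K A : ℝ) : ℝ :=
  (2 * K * (2 * (c + |c'|) + 2 * K) / c + 2 * (c + |c'|) ^ 2 * (384 / A + K) / c ^ 2) * (1 + A * Real.exp (1 / 2)) * (1 + 4 / α) ^ 2

lemma lam_bd (α y M B : ℝ) (hα : 0 < α) (hM : 1 ≤ M) (hy : M ≤ y) (hB : 0 ≤ B) :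
    (1 + B + Real.log y) ^ 2 ≤ (1 + B + Real.log M) ^ 2 * ((1 + 4 / α) ^ 2 * (y / M) ^ (α / 2)) := by
  have hx : 1 ≤ y / M := by rw [le_div_iff₀ (by linarith)]; linarith
  have e : Real.log y = Real.log M + Real.log (y / M) := by
    rw [Real.log_div (by linarith) (by linarith)]; ring
  have hlM := Real.log_nonneg hM
  have hlx := Real.log_nonneg hx
  have h1 := Real.log_le_rpow_div (x := y / M) (ε := α / 4) (by linarith) (by positivity)
  have h2 : 1 ≤ (y / M) ^ (α / 4) := Real.one_le_rpow hx (by positivity)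
  have h3 : 1 + Real.log (y / M) ≤ (1 + 4 / α) * (y / M) ^ (α / 4) := by
    have : (y / M) ^ (α / 4) / (α / 4) = 4 / α * (y / M) ^ (α / 4) := by field_simp
    linarith
  have h4 : 1 + B + Real.log y ≤ (1 + B + Real.log M) * ((1 + 4 / α) * (y / M) ^ (α / 4)) := by
    have : 1 + B + Real.log y ≤ (1 + B + Real.log M) * (1 + Real.log (y / M)) := by
      rw [e]; nlinarith [mul_nonneg hB hlx, mul_nonneg hlM hlx]
    refine this.trans ?_
    gcongr
  have h5 : ((y / M) ^ (α / 4)) ^ 2 = (y / M) ^ (α / 2) := by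
    rw [← Real.rpow_natCast, ← Real.rpow_mul (by linarith)]; congr 1; push_cast; ring
  have h0 : 0 ≤ 1 + B + Real.log y := by linarith
  calc _ ≤ ((1 + B + Real.log M) * ((1 + 4 / α) * (y / M) ^ (α / 4))) ^ 2 := by gcongr
    _ = _ := by rw [← h5]; ring

lemma regD {A Y0 M : ℝ} (h : Ctx α c c' K q b d l) (B : Big c K A Y0 q M) (y : ℝ) (hy : M + 1 ≤ y) :
    |l y ^ 2 / (gauss y + d y) - (Ioi M).indicator (mainT α c c' q b) y| ≤
      CD α c c' K A * (q * (1 + |b| + Real.log M) ^ 2 * M ^ (-1 - α / 2)) * y ^ (-1 - α / 2) := by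
  have hM := B.hM
  have hy1 : 1 ≤ y := by linarith
  have hyp : 0 < y := by linarith
  have hMp : 0 < M := by linarith
  have hq := h.hq
  have hc := h.hc
  have hK := h.hK
  have hα := h.hα
  have hA := B.hA
  rw [indicator_of_mem (show y ∈ Ioi M by simp; linarith)]
  have hYp : 0 < y ^ (-(α + 1)) := Real.rpow_pos_of_pos hyp _
  have hg : gauss y ≤ 384 / A * q * (y ^ (-(α + 1)) * (1 / y + q)) := by
    have g1 : gauss y ≤ Real.exp (-(y ^ 2) / 2) := by
      unfold gauss
      have : (Real.sqrt (2 * Real.pi))⁻¹ ≤ 1 := by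
        apply inv_le_one_of_one_le₀
        rw [Real.one_le_sqrt]; linarith [Real.pi_gt_three]
      have e := Real.exp_pos (-(y ^ 2) / 2)
      nlinarith
    have g2 : Real.exp (-(y ^ 2) / 2) ≤ Real.exp (-(M ^ 2) / 2) * Real.exp (-(y / 2)) := by
      rw [← Real.exp_add]; apply Real.exp_le_exp.2; nlinarith
    have g3 := rpow_exp_bd (y / 2) (α + 2) (by linarith) (by linarith [h.hα2])
    rw [Real.div_rpow hyp.le (by norm_num)] at g3
    have g4 : (2:ℝ) ^ (α + 2) ≤ 2 ^ (4:ℝ) := Real.rpow_le_rpow_of_exponent_le (by norm_num) (by linarith [h.hα2])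
    rw [show (2:ℝ) ^ (4:ℝ) = 16 by norm_num] at g4
    have g0 : (0:ℝ) < 2 ^ (α + 2) := by positivity
    have gy : 0 < y ^ (α + 2) := by positivity
    have ee := Real.exp_pos (-(y / 2))
    have g5 : y ^ (α + 2) * Real.exp (-(y / 2)) ≤ 384 := by
      rw [div_mul_eq_mul_div, div_le_iff₀ g0] at g3
      linarith
    have g6 : Real.exp (-(y / 2)) ≤ 384 * (y ^ (-(α + 1)) * (1 / y)) := by
      have : y ^ (-(α + 1)) * (1 / y) = (y ^ (α + 2))⁻¹ := by
        rw [one_div, ← Real.rpow_neg_one, ← Real.rpow_add hyp, ← Real.rpow_neg hyp.le]; ring_nf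
      rw [this, ← div_eq_mul_inv, le_div_iff₀ gy]; linarith
    have g7 : Real.exp (-(M ^ 2) / 2) = q / A := by rw [B.hqM]; field_simp
    rw [g7] at g2
    calc gauss y ≤ q / A * (384 * (y ^ (-(α + 1)) * (1 / y))) := g1.trans (g2.trans (by gcongr))
      _ ≤ q / A * (384 * (y ^ (-(α + 1)) * (1 / y + q))) := by gcongr; linarith
      _ = _ := by ring
  have hp := h.pt y (384 / A) (by positivity) hy1 (B.hKε hK y (by linarith [B.hYM])) hg
  have hε : 1 / y + q ≤ (1 + A * Real.exp (1 / 2)) * (1 / M) := by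
    have e1 : 1 / y ≤ 1 / M := one_div_le_one_div_of_le hMp (by linarith)
    have e2 : Real.exp (-M) ≤ 1 / M := by
      rw [Real.exp_neg, ← one_div]; apply one_div_le_one_div_of_le hMp
      linarith [Real.add_one_le_exp M]
    have e3 := mul_le_mul_of_nonneg_left e2 (by positivity : 0 ≤ A * Real.exp (1 / 2))
    have := B.qe
    linarith
  have hlam := lam_bd α y M |b| hα (by linarith) (by linarith) (abs_nonneg b)
  refine hp.trans ?_
  have epow : y ^ (-(α + 1)) * (y / M) ^ (α / 2) * (1 / M) = M ^ (-1 - α / 2) * y ^ (-1 - α / 2) := by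
    rw [Real.div_rpow hyp.le hMp.le, show (-1 - α / 2) = -(1 + α / 2) by ring]
    have e1 : y ^ (-(α + 1)) * y ^ (α / 2) = y ^ (-(1 + α / 2)) := by rw [← Real.rpow_add hyp]; ring_nf
    have e2 : M ^ (-(1 + α / 2)) = (M ^ (α / 2))⁻¹ * (1 / M) := by
      rw [Real.rpow_neg hMp.le, Real.rpow_add hMp, Real.rpow_one]; field_simp
    rw [e2, ← e1]; ring
  set Λ := (1 + |b| + Real.log M) ^ 2
  set C0 := (2 * K * (2 * (c + |c'|) + 2 * K) / c + 2 * (c + |c'|) ^ 2 * (384 / A + K) / c ^ 2) with hC0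
  have hC0p : 0 ≤ C0 := by
    have := abs_nonneg c'
    rw [hC0]; positivity
  calc _ ≤ C0 * (q * y ^ (-(α + 1)) * (Λ * ((1 + 4 / α) ^ 2 * (y / M) ^ (α / 2))) * ((1 + A * Real.exp (1 / 2)) * (1 / M))) := by gcongr
    _ = C0 * (1 + A * Real.exp (1 / 2)) * (1 + 4 / α) ^ 2 * (q * Λ) * (y ^ (-(α + 1)) * (y / M) ^ (α / 2) * (1 / M)) := by ring
    _ = _ := by rw [epow]; unfold CD; ring

end Ctx

end

section

lemma gen_int (D : ℝ → ℝ) (M c1 c2 c3 s : ℝ) (hD : AEStronglyMeasurable D volume) (hM : 2 ≤ M) (hs : s < -1)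
    (h1 : ∀ y, 0 < y → y ≤ M - 1 → |D y| ≤ c1)
    (h2 : ∀ y, M - 1 ≤ y → y ≤ M + 1 → |D y| ≤ c2)
    (h3 : ∀ y, M + 1 ≤ y → |D y| ≤ c3 * y ^ s) :
    IntegrableOn D (Ioi 0) ∧
      |∫ y in Ioi 0, D y| ≤ c1 * (M - 1) + c2 * 2 + c3 * (-(M + 1) ^ (s + 1) / (s + 1)) := by
  have i1 : IntegrableOn D (Ioc 0 (M - 1)) := by
    refine Measure.integrableOn_of_bounded (M := c1) (by simp) hD ?_
    refine (ae_restrict_iff' measurableSet_Ioc).2 (ae_of_all _ fun y hy => h1 y hy.1 hy.2)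
  have i2 : IntegrableOn D (Ioc (M - 1) (M + 1)) := by
    refine Measure.integrableOn_of_bounded (M := c2) (by simp) hD ?_
    refine (ae_restrict_iff' measurableSet_Ioc).2 (ae_of_all _ fun y hy => h2 y hy.1.le hy.2)
  have ip : IntegrableOn (fun y : ℝ => c3 * y ^ s) (Ioi (M + 1)) :=
    (integrableOn_Ioi_rpow_of_lt hs (by linarith)).const_mul c3
  have hb3 : ∀ᵐ y ∂(volume.restrict (Ioi (M + 1))), ‖D y‖ ≤ c3 * y ^ s :=
    (ae_restrict_iff' measurableSet_Ioi).2 (ae_of_all _ fun y hy => h3 y (le_of_lt hy))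
  have i3 : IntegrableOn D (Ioi (M + 1)) := Integrable.mono' ip hD.restrict hb3
  have e1 : Ioc (M - 1) (M + 1) ∪ Ioi (M + 1) = Ioi (M - 1) := Ioc_union_Ioi_eq_Ioi (by linarith)
  have e2 : Ioc 0 (M - 1) ∪ Ioi (M - 1) = Ioi 0 := Ioc_union_Ioi_eq_Ioi (by linarith)
  have i4 : IntegrableOn D (Ioi (M - 1)) := by rw [← e1]; exact i2.union i3
  have i5 : IntegrableOn D (Ioi 0) := by rw [← e2]; exact i1.union i4
  refine ⟨i5, ?_⟩
  have d1 : ∫ y in Ioi (M - 1), D y = (∫ y in Ioc (M - 1) (M + 1), D y) + ∫ y in Ioi (M + 1), D y := by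
    rw [← e1]
    exact setIntegral_union (Ioc_disjoint_Ioi le_rfl) measurableSet_Ioi i2 i3
  have d2 : ∫ y in Ioi 0, D y = (∫ y in Ioc 0 (M - 1), D y) + ∫ y in Ioi (M - 1), D y := by
    rw [← e2]
    exact setIntegral_union (Ioc_disjoint_Ioi le_rfl) measurableSet_Ioi i1 i4
  have b1 : |∫ y in Ioc 0 (M - 1), D y| ≤ c1 * (M - 1) := by
    have := norm_setIntegral_le_of_norm_le_const (μ := volume) (s := Ioc 0 (M - 1)) (f := D) (C := c1) (by simp)
      (fun y hy => h1 y hy.1 hy.2)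
    rw [Real.volume_real_Ioc_of_le (by linarith)] at this
    simpa using this
  have b2 : |∫ y in Ioc (M - 1) (M + 1), D y| ≤ c2 * 2 := by
    have := norm_setIntegral_le_of_norm_le_const (μ := volume) (s := Ioc (M - 1) (M + 1)) (f := D) (C := c2) (by simp)
      (fun y hy => h2 y hy.1.le hy.2)
    rw [Real.volume_real_Ioc_of_le (by linarith)] at this
    rw [show (M + 1) - (M - 1) = 2 by ring] at this
    simpa using this
  have b3 : |∫ y in Ioi (M + 1), D y| ≤ c3 * (-(M + 1) ^ (s + 1) / (s + 1)) := by
    have := norm_integral_le_of_norm_le ip hb3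
    rw [integral_const_mul, integral_Ioi_rpow_of_lt hs (by linarith)] at this
    simpa using this
  rw [d2, d1]
  refine (abs_add_le _ _).trans ?_
  have := abs_add_le (∫ y in Ioc (M - 1) (M + 1), D y) (∫ y in Ioi (M + 1), D y)
  linarith

lemma mainT_tendsto (α D : ℝ) (hα : 0 < α) :
    Tendsto (fun y : ℝ => y ^ (-α) * ((D - Real.log y) ^ 2 - 2 * (D - Real.log y) / α + 2 / α ^ 2)) atTop (𝓝 0) := by
  have h1 : Tendsto (fun y : ℝ => y ^ (-(α / 2))) atTop (𝓝 0) := tendsto_rpow_neg_atTop (by linarith)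
  have h2 : Tendsto (fun y : ℝ => Real.log y / y ^ (α / 2)) atTop (𝓝 0) :=
    (isLittleO_log_rpow_atTop (by linarith)).tendsto_div_nhds_zero
  have h3 := (h1.const_mul D).sub h2
  have h4 := ((h3.mul h3).sub ((h1.mul h3).const_mul (2 / α))).add ((h1.mul h1).const_mul (2 / α ^ 2))
  simp only [mul_zero, sub_zero, add_zero] at h4
  refine h4.congr' ?_
  filter_upwards [eventually_gt_atTop 0] with y hy
  have e : y ^ (-α) = y ^ (-(α / 2)) * y ^ (-(α / 2)) := by
    rw [← Real.rpow_add hy]; congr 1; ring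
  have e2 : Real.log y / y ^ (α / 2) = Real.log y * y ^ (-(α / 2)) := by
    rw [Real.rpow_neg hy.le]; rfl
  rw [e, e2]
  ring

lemma mainT_integral (α c c' q b M : ℝ) (hα : 0 < α) (hc : 0 < c) (hq : 0 < q) (hM : 1 ≤ M) :
    IntegrableOn (mainT α c c' q b) (Ioi M) ∧
    ∫ y in Ioi M, mainT α c c' q b y =
      q * c * M ^ (-α) / α * ((b + c' / c - Real.log M - 1 / α) ^ 2 + 1 / α ^ 2) := by
  set D := b + c' / c with hD
  set F : ℝ → ℝ := fun y => -(q * c / α) * (y ^ (-α) * ((D - Real.log y) ^ 2 - 2 * (D - Real.log y) / α + 2 / α ^ 2)) with hF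
  have hd : ∀ y ∈ Ici M, HasDerivAt F (mainT α c c' q b y) y := by
    intro y hy
    have hy0 : 0 < y := by have : M ≤ y := hy; linarith
    have hl := (Real.hasDerivAt_log hy0.ne').const_sub D
    have hp := Real.hasDerivAt_rpow_const (x := y) (p := -α) (Or.inl hy0.ne')
    have := (hp.mul (((hl.pow 2).sub ((hl.const_mul 2).div_const α)).add_const (2 / α ^ 2))).const_mul (-(q * c / α))
    refine this.congr_deriv ?_
    have e1 : y ^ (-α - 1) = y ^ (-(α + 1)) := by congr 1; ring
    have e2 : y ^ (-α) = y ^ (-(α + 1)) * y := by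
      rw [← Real.rpow_add_one hy0.ne']; congr 1; ring
    unfold mainT
    simp only [Pi.sub_apply, Pi.pow_apply]
    have e3 : c * (b - Real.log y) + c' = c * (D - Real.log y) := by rw [hD]; field_simp; ring
    rw [e1, e2, e3]
    clear_value D
    push_cast
    field_simp
    ring
  have hnn : ∀ y ∈ Ioi M, 0 ≤ mainT α c c' q b y := by
    intro y hy
    have hy0 : 0 < y := by have : M < y := hy; linarith
    unfold mainT; positivity
  have ht : Tendsto F atTop (𝓝 0) := by
    have := (mainT_tendsto α D hα).const_mul (-(q * c / α))
    simpa [hF] using this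
  refine ⟨integrableOn_Ioi_deriv_of_nonneg' hd hnn ht, ?_⟩
  rw [integral_Ioi_of_hasDerivAt_of_nonneg' hd hnn ht]
  simp only [hF]
  field_simp
  ring

def CT (α c c' K A Y0 : ℝ) : ℝ := Ctx.CA c c' K A Y0 * 24 +
  64 * (2 * (c + |c'| + 2 * K) ^ 2 / c + (c + |c'|) ^ 2 / c) + Ctx.CD α c c' K A * (2 / α)

set_option maxHeartbeats 1000000 in
lemma half_int {α c c' K q b A Y0 M : ℝ} {d l : ℝ → ℝ} (h : Ctx α c c' K q b d l) (B : Ctx.Big c K A Y0 q M) :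
    |(∫ y in Ioi 0, l y ^ 2 / (gauss y + d y)) -
      q * c * M ^ (-α) / α * ((b + c' / c - Real.log M - 1 / α) ^ 2 + 1 / α ^ 2)| ≤
      CT α c c' K A Y0 * (q * (1 + |b| + Real.log M) ^ 2 * M ^ (-(α + 1))) := by
  have hM := B.hM
  have hq := h.hq
  have hc := h.hc
  have hα := h.hα
  have hα2 := h.hα2
  have hK := h.hK
  have hA := B.hA
  have hg := gauss_pos Y0
  have hc' := abs_nonneg c'
  have hM0 : 0 < M := by linarith
  obtain ⟨mi, me⟩ := mainT_integral α c c' q b M hα hc hq (by linarith)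
  have ii : Integrable ((Ioi M).indicator (mainT α c c' q b)) := (integrable_indicator_iff measurableSet_Ioi).2 mi
  have ie : ∫ y in Ioi 0, (Ioi M).indicator (mainT α c c' q b) y = ∫ y in Ioi M, mainT α c c' q b y := by
    rw [setIntegral_indicator measurableSet_Ioi]
    congr 2
    ext y; simp; intro hy; linarith
  have hmeas : AEStronglyMeasurable (fun y => l y ^ 2 / (gauss y + d y) - (Ioi M).indicator (mainT α c c' q b) y) volume := by
    refine AEStronglyMeasurable.sub ?_ ii.aestronglyMeasurable
    exact ((h.hlc.measurable.pow_const 2).div (gauss_continuous.measurable.add h.hdc.measurable)).aestronglyMeasurable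
  obtain ⟨Di, Db⟩ := gen_int _ M _ _ _ (-1 - α / 2) hmeas hM (by linarith)
    (fun y hy0 hy => by
      rw [indicator_of_notMem (show y ∉ Ioi M by simp; linarith), sub_zero]
      exact Ctx.regAB h B y hy0 hy)
    (fun y hy0 hy => Ctx.regC h B y hy0 hy) (fun y hy => Ctx.regD h B y hy)
  have li : IntegrableOn (fun y => l y ^ 2 / (gauss y + d y)) (Ioi 0) := by
    have := Di.add ii.integrableOn
    refine this.congr (ae_of_all _ fun y => ?_)
    simp
  rw [integral_sub li ii.integrableOn, ie, me] at Db
  refine Db.trans ?_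
  set Λ := 1 + |b| + Real.log M with hΛ
  have x1 : Real.exp (-M) * (M - 1) ≤ 24 * M ^ (-(α + 1)) := by
    have e := rpow_exp_bd M (α + 2) (by linarith) (by linarith)
    have e2 : M ^ (α + 2) = M * M ^ (α + 1) := by
      rw [mul_comm, ← Real.rpow_add_one hM0.ne']; congr 1; ring
    rw [e2] at e
    have hp : 0 < M ^ (α + 1) := by positivity
    rw [Real.rpow_neg hM0.le, ← div_eq_mul_inv, le_div_iff₀ hp]
    have : 0 < Real.exp (-M) := Real.exp_pos _
    nlinarith [mul_pos hp this]
  have x2 : -(M + 1) ^ (-1 - α / 2 + 1) / (-1 - α / 2 + 1) ≤ 2 / α * M ^ (-(α / 2)) := by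
    have : (M + 1) ^ (-(α / 2)) ≤ M ^ (-(α / 2)) := Real.rpow_le_rpow_of_nonpos hM0 (by linarith) (by linarith)
    rw [show -1 - α / 2 + 1 = -(α / 2) by ring]
    rw [show -(M + 1) ^ (-(α / 2)) / (-(α / 2)) = 2 / α * (M + 1) ^ (-(α / 2)) by field_simp]
    gcongr
  have x3 : M ^ (-1 - α / 2) * M ^ (-(α / 2)) = M ^ (-(α + 1)) := by
    rw [← Real.rpow_add hM0]; congr 1; ring
  have hCA : 0 ≤ Ctx.CA c c' K A Y0 := by unfold Ctx.CA; positivity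
  have hCD : 0 ≤ Ctx.CD α c c' K A := by unfold Ctx.CD; positivity
  have y1 := mul_le_mul_of_nonneg_left x1 (show 0 ≤ Ctx.CA c c' K A Y0 * (q * Λ ^ 2) by positivity)
  have y2 := mul_le_mul_of_nonneg_left x2 (show 0 ≤ Ctx.CD α c c' K A * (q * Λ ^ 2 * M ^ (-1 - α / 2)) by positivity)
  have y3 : Ctx.CD α c c' K A * (q * Λ ^ 2 * M ^ (-1 - α / 2)) * (2 / α * M ^ (-(α / 2))) =
     Ctx.CD α c c' K A * (2 / α) * (q * Λ ^ 2 * M ^ (-(α + 1))) := by rw [← x3]; ring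
  rw [y3] at y2
  have y1' : Ctx.CA c c' K A Y0 * (q * Λ ^ 2 * Real.exp (-M)) * (M - 1) ≤ Ctx.CA c c' K A Y0 * 24 * (q * Λ ^ 2 * M ^ (-(α + 1))) := by
    calc _ = Ctx.CA c c' K A Y0 * (q * Λ ^ 2) * (Real.exp (-M) * (M - 1)) := by ring
      _ ≤ _ := y1
      _ = _ := by ring
  unfold CT
  refine (add_le_add (add_le_add y1' le_rfl) y2).trans (le_of_eq ?_)
  ring

end

section

def KK (α : ℝ) : ℝ := KF α + 2 * KE α

lemma ctx_mk (α q b : ℝ) (hα : 0 < α) (hα2 : α < 2) (hq : 0 < q) (hq1 : q ≤ 1) :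
    Ctx α (cc α) (cd α) (KK α) q b (dF q α) (fun y => -q * dL q α b y) := by
  have k1 := KF_nonneg α hα
  have k2 := KE_nonneg α hα
  have hb := abs_nonneg b
  refine ⟨hα, hα2, cc_pos α hα hα2, by unfold KK; linarith, hq, hq1, ?_, ?_, ?_, ?_, ?_, ?_⟩
  · intro y hy
    refine (dF_asymp q α y hq.le hα hα2 hy).trans ?_
    have : 0 < y := by linarith
    have h2 : 0 ≤ y ^ (-(α + 1)) * (1 / y + q) := by positivity
    unfold KK
    gcongr
    linarith
  · intro y hy
    have h := dL_asymp q α b y hq.le hα hα2 hy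
    have : 0 < y := by linarith
    have h2 : 0 ≤ y ^ (-(α + 1)) * (1 / y + q) := by positivity
    have e : -q * dL q α b y - q * (y ^ (-(α + 1)) * (cc α * (b - Real.log y) + cd α)) =
      -q * (dL q α b y + y ^ (-(α + 1)) * (cc α * (b - Real.log y) + cd α)) := by ring
    simp only [e]
    rw [abs_mul, abs_neg, abs_of_pos hq]
    calc _ ≤ q * (2 * KE α * (1 + |b|) * (y ^ (-(α + 1)) * (1 / y + q))) := by gcongr
      _ = 2 * KE α * q * (1 + |b|) * (y ^ (-(α + 1)) * (1 / y + q)) := by ring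
      _ ≤ _ := by unfold KK; gcongr; linarith
  · intro y
    refine (dF_bound q α y hq.le hα hα2).trans ?_
    unfold KK; gcongr; linarith
  · intro y
    have h := dL_bound q α b y hq.le hα hα2
    rw [abs_mul, abs_neg, abs_of_pos hq]
    calc _ ≤ q * (KF α * (1 + |b|)) := by gcongr
      _ = KF α * q * (1 + |b|) := by ring
      _ ≤ _ := by unfold KK; gcongr; linarith
  · exact dF_cont q α hq.le hα hα2
  · exact continuous_const.mul (dL_cont q α b hq.le hα hα2)

lemma full_int (n : ℕ) (α w b A Y0 M : ℝ) (hα : 0 < α) (hα2 : α < 2) (hw : 0 < w) (hw1 : w ^ α ≤ 1)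
    (hb : b = -(α * ((Real.log n - Real.log (Real.log n)) / (2 * α) - Real.log n / α ^ 2)) + Real.log w)
    (B : Ctx.Big (cc α) (KK α) A Y0 (w ^ α) M) :
    |(∫ y : ℝ, lFun n α y w ^ 2 / fFun α y w) -
      2 * (w ^ α * cc α * M ^ (-α) / α * ((b + cd α / cc α - Real.log M - 1 / α) ^ 2 + 1 / α ^ 2))| ≤
      2 * (CT α (cc α) (cd α) (KK α) A Y0 * (w ^ α * (1 + |b| + Real.log M) ^ 2 * M ^ (-(α + 1)))) := by
  have hq : 0 < w ^ α := by positivity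
  have h := half_int (ctx_mk α (w ^ α) b hα hα2 hq hw1) B
  set G : ℝ → ℝ := fun y => (-(w ^ α) * dL (w ^ α) α b y) ^ 2 / (gauss y + dF (w ^ α) α y) with hG
  have e1 : (∫ y : ℝ, lFun n α y w ^ 2 / fFun α y w) = ∫ y : ℝ, G |y| := by
    congr 1
    ext y
    have hE : G |y| = G y := by
      rcases abs_choice y with hy | hy
      · rw [hy]
      · rw [hy]; simp only [hG, dF_even, dL_even, gauss, neg_sq]
    rw [hE]
    simp only [hG, lFun]
    rw [hk_eq α y w _ hα hα2 hw, fFun_eq α y w hα hα2 hw, ← hb]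
  rw [e1, integral_comp_abs, ← mul_sub, abs_mul, abs_of_pos (by norm_num : (0:ℝ) < 2)]
  gcongr

lemma CT_nonneg (α c c' K A Y0 : ℝ) (hα : 0 < α) (hc : 0 < c) (hK : 0 ≤ K) (hA : 0 < A) : 0 ≤ CT α c c' K A Y0 := by
  have hg := gauss_pos Y0
  have hc' := abs_nonneg c'
  unfold CT Ctx.CA Ctx.CD
  positivity

def RR (σ δ α : ℝ) : ℝ := 2 + |Real.log (δ / σ)| + |Real.log (2 - α)|

set_option maxHeartbeats 1600000 in
lemma single_n (n : ℕ) (σ δ α Y0 : ℝ) (hσ : 0 < σ) (hδ : 0 < δ) (hα : 0 < α) (hα2 : α < 2)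
    (hLL : 1 ≤ Real.log (Real.log n)) (hL : 1 ≤ Real.log n) (hn : 1 ≤ n)
    (hq1 : (δ / σ) ^ α * Real.exp (-(Mn n α ^ 2) / 2) ≤ 1)
    (B : Ctx.Big (cc α) (KK α) ((δ / σ) ^ α) Y0 ((δ / σ) ^ α * Real.exp (-(Mn n α ^ 2) / 2)) (Mn n α)) :
      |(∫ y : ℝ, lFun n α y (wn n σ δ α) ^ 2 / fFun α y (wn n σ δ α))
          - kappa0 σ δ α * (kappa1 σ δ α ^ 2 + 1 / α ^ 2) /
            ((n : ℝ) ^ (1 - α / 2) * Real.log n ^ (α / 2))| ≤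
        (2 * CT α (cc α) (cd α) (KK α) ((δ / σ) ^ α) Y0 * (δ / σ) ^ α * RR σ δ α ^ 2 * (2 - α) ^ (-((α + 1) / 2)) + 1)
         * (1 / ((n : ℝ) ^ (1 - α / 2) * Real.log n ^ (α / 2))) *
          (Real.log (Real.log n) ^ 3 / Real.log n ^ (min (1 / 4 : ℝ) α)) := by
  have hnp : (0:ℝ) < n := by exact_mod_cast hn
  have hr : 0 < δ / σ := by positivity
  have hLp : 0 < Real.log n := by linarith
  have h2α : 0 < 2 - α := by linarith
  have hwe : wn n σ δ α = (n : ℝ) ^ ((1 : ℝ) / 2 - 1 / α) * (δ / σ) := by unfold wn; ring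
  have hw : 0 < wn n σ δ α := by rw [hwe]; positivity
  have hM2 : Mn n α ^ 2 = (2 - α) * Real.log n := by
    unfold Mn; exact Real.sq_sqrt (by positivity)
  have hMr : Mn n α = ((2 - α) * Real.log n) ^ (1 / 2 : ℝ) := by unfold Mn; exact Real.sqrt_eq_rpow _
  have hMp : 0 < Mn n α := by have := B.hM; linarith
  have hexp : Real.exp (-(Mn n α ^ 2) / 2) = ((n : ℝ) ^ (1 - α / 2))⁻¹ := by
    rw [hM2, ← Real.rpow_neg hnp.le, Real.rpow_def_of_pos hnp]; congr 1; ring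
  have hwα : wn n σ δ α ^ α = (δ / σ) ^ α * Real.exp (-(Mn n α ^ 2) / 2) := by
    rw [hexp, hwe, Real.mul_rpow (by positivity) hr.le, ← Real.rpow_mul hnp.le, ← Real.rpow_neg hnp.le, mul_comm]
    congr 2; field_simp; ring
  have hlw : Real.log (wn n σ δ α) = (1 / 2 - 1 / α) * Real.log n + Real.log (δ / σ) := by
    rw [hwe, Real.log_mul (by positivity) hr.ne', Real.log_rpow hnp]
  have hlM : Real.log (Mn n α) = (Real.log (2 - α) + Real.log (Real.log n)) / 2 := by
    rw [hMr, Real.log_rpow (by positivity), Real.log_mul h2α.ne' hLp.ne']; ring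
  set b := Real.log (Real.log n) / 2 + Real.log (δ / σ) with hbd
  have hb : b = -(α * ((Real.log n - Real.log (Real.log n)) / (2 * α) - Real.log n / α ^ 2)) + Real.log (wn n σ δ α) := by
    rw [hlw, hbd]; field_simp; ring
  have h := full_int n α (wn n σ δ α) b _ Y0 (Mn n α) hα hα2 hw (by rw [hwα]; exact hq1) hb (by rw [hwα]; exact B)
  have hMα : Mn n α ^ (-α) = (2 - α) ^ (-(α / 2)) * (Real.log n ^ (α / 2))⁻¹ := by
    rw [hMr, ← Real.rpow_mul (by positivity), Real.mul_rpow h2α.le hLp.le, ← Real.rpow_neg hLp.le]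
    congr 2 <;> ring
  have hMα1 : Mn n α ^ (-(α + 1)) = (2 - α) ^ (-((α + 1) / 2)) * ((Real.log n ^ (α / 2))⁻¹ * Real.log n ^ (-(1 / 2) : ℝ)) := by
    rw [hMr, ← Real.rpow_mul (by positivity), Real.mul_rpow h2α.le hLp.le, ← Real.rpow_neg hLp.le, ← Real.rpow_add hLp]
    congr 2 <;> ring
  have hκ : b + cd α / cc α - Real.log (Mn n α) - 1 / α = kappa1 σ δ α := by
    unfold kappa1
    rw [cAlpha_deriv α hα hα2, cAlpha_eq α hα hα2, hlM, hbd]; ring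
  have hmain : 2 * (wn n σ δ α ^ α * cc α * Mn n α ^ (-α) / α * ((b + cd α / cc α - Real.log (Mn n α) - 1 / α) ^ 2 + 1 / α ^ 2))
     = kappa0 σ δ α * (kappa1 σ δ α ^ 2 + 1 / α ^ 2) / ((n : ℝ) ^ (1 - α / 2) * Real.log n ^ (α / 2)) := by
    rw [hκ, hwα, hexp, hMα]
    unfold kappa0
    rw [cAlpha_eq α hα hα2, Real.rpow_neg h2α.le]
    generalize kappa1 σ δ α = k
    generalize (δ / σ) ^ α = A
    have p1 : 0 < (n : ℝ) ^ (1 - α / 2) := by positivity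
    have p2 : 0 < Real.log n ^ (α / 2) := by positivity
    have p3 : 0 < (2 - α) ^ (α / 2) := by positivity
    generalize (n : ℝ) ^ (1 - α / 2) = P1 at *
    generalize Real.log n ^ (α / 2) = P2 at *
    generalize (2 - α) ^ (α / 2) = P3 at *
    field_simp
  rw [hmain] at h
  refine h.trans ?_
  have hΛ0 : 0 ≤ 1 + |b| + Real.log (Mn n α) := by
    have := Real.log_nonneg (show (1:ℝ) ≤ Mn n α by have := B.hM; linarith)
    positivity
  have hΛ : 1 + |b| + Real.log (Mn n α) ≤ RR σ δ α * Real.log (Real.log n) := by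
    have a1 : |b| ≤ Real.log (Real.log n) / 2 + |Real.log (δ / σ)| := by
      rw [hbd]
      refine (abs_add_le _ _).trans ?_
      rw [abs_of_nonneg (by linarith : 0 ≤ Real.log (Real.log n) / 2)]
    have a2 := le_abs_self (Real.log (2 - α))
    have a3 := abs_nonneg (Real.log (2 - α))
    have a4 := abs_nonneg (Real.log (δ / σ))
    rw [hlM]
    unfold RR
    nlinarith
  have hΛ2 : (1 + |b| + Real.log (Mn n α)) ^ 2 ≤ RR σ δ α ^ 2 * Real.log (Real.log n) ^ 3 := by
    calc _ ≤ (RR σ δ α * Real.log (Real.log n)) ^ 2 := by gcongr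
      _ = RR σ δ α ^ 2 * Real.log (Real.log n) ^ 2 := by ring
      _ ≤ _ := mul_le_mul_of_nonneg_left (pow_le_pow_right₀ hLL (by norm_num)) (sq_nonneg _)
  have hpow : Real.log n ^ (-(1 / 2) : ℝ) ≤ (Real.log n ^ (min (1 / 4 : ℝ) α))⁻¹ := by
    rw [← Real.rpow_neg hLp.le]
    refine Real.rpow_le_rpow_of_exponent_le hL ?_
    have := min_le_left (1 / 4 : ℝ) α
    linarith
  have hCT := CT_nonneg α (cc α) (cd α) (KK α) ((δ / σ) ^ α) Y0 hα (cc_pos α hα hα2)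
    (by have k1 := KF_nonneg α hα; have k2 := KE_nonneg α hα; unfold KK; linarith) (by positivity)
  rw [hwα, hexp, hMα1]
  have hA : 0 < (δ / σ) ^ α := by positivity
  have p1 : 0 < (n : ℝ) ^ (1 - α / 2) := by positivity
  have p2 : 0 < Real.log n ^ (α / 2) := by positivity
  have p3 : 0 < (2 - α) ^ (-((α + 1) / 2)) := by positivity
  have p4 : 0 < Real.log n ^ (min (1 / 4 : ℝ) α) := by positivity
  have hLL0 : 0 ≤ Real.log (Real.log n) := by linarith
  set T := CT α (cc α) (cd α) (KK α) ((δ / σ) ^ α) Y0 with hT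
  calc 2 * (T * ((δ / σ) ^ α * ((n : ℝ) ^ (1 - α / 2))⁻¹ * (1 + |b| + Real.log (Mn n α)) ^ 2 *
          ((2 - α) ^ (-((α + 1) / 2)) * ((Real.log n ^ (α / 2))⁻¹ * Real.log n ^ (-(1 / 2) : ℝ)))))
      ≤ 2 * (T * ((δ / σ) ^ α * ((n : ℝ) ^ (1 - α / 2))⁻¹ * (RR σ δ α ^ 2 * Real.log (Real.log n) ^ 3) *
          ((2 - α) ^ (-((α + 1) / 2)) * ((Real.log n ^ (α / 2))⁻¹ * (Real.log n ^ (min (1 / 4 : ℝ) α))⁻¹)))) := by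
        gcongr
    _ = (2 * T * (δ / σ) ^ α * RR σ δ α ^ 2 * (2 - α) ^ (-((α + 1) / 2)))
         * (1 / ((n : ℝ) ^ (1 - α / 2) * Real.log n ^ (α / 2))) *
          (Real.log (Real.log n) ^ 3 / Real.log n ^ (min (1 / 4 : ℝ) α)) := by
        clear_value T
        generalize (n : ℝ) ^ (1 - α / 2) = P1 at p1 ⊢
        generalize Real.log n ^ (α / 2) = P2 at p2 ⊢
        generalize Real.log n ^ (min (1 / 4 : ℝ) α) = P4 at p4 ⊢
        generalize (2 - α) ^ (-((α + 1) / 2)) = P3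
        generalize (δ / σ) ^ α = A
        field_simp
    _ ≤ _ := by
        gcongr
        linarith

theorem statement13' (σ δ α : ℝ) (hσ : 0 < σ) (hδ : 0 < δ) (hα : α ∈ Set.Ioo (0 : ℝ) 2) :
    ∃ C > (0 : ℝ), ∃ N : ℕ, ∀ n ≥ N,
      |(∫ y : ℝ, lFun n α y (wn n σ δ α) ^ 2 / fFun α y (wn n σ δ α))
          - kappa0 σ δ α * (kappa1 σ δ α ^ 2 + 1 / α ^ 2) /
            ((n : ℝ) ^ (1 - α / 2) * Real.log n ^ (α / 2))| ≤
        C * (1 / ((n : ℝ) ^ (1 - α / 2) * Real.log n ^ (α / 2))) *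
          (Real.log (Real.log n) ^ 3 / Real.log n ^ (min (1 / 4 : ℝ) α)) := by
  obtain ⟨hα0, hα2⟩ := hα
  have hc := cc_pos α hα0 hα2
  have hK : 0 ≤ KK α := by
    have k1 := KF_nonneg α hα0; have k2 := KE_nonneg α hα0; unfold KK; linarith
  have hA : 0 < (δ / σ) ^ α := by positivity
  set Y0 := 1 + 4 * KK α / cc α with hY0d
  have hY0 : 1 ≤ Y0 := by
    have : 0 ≤ 4 * KK α / cc α := by positivity
    linarith
  have hCT := CT_nonneg α (cc α) (cd α) (KK α) ((δ / σ) ^ α) Y0 hα0 hc hK hA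
  have h2α : 0 < 2 - α := by linarith
  have tL : Tendsto (fun n : ℕ => Real.log n) atTop atTop := Real.tendsto_log_atTop.comp tendsto_natCast_atTop_atTop
  have tLL : Tendsto (fun n : ℕ => Real.log (Real.log n)) atTop atTop := Real.tendsto_log_atTop.comp tL
  have tP : Tendsto (fun n : ℕ => (2 - α) * Real.log n) atTop atTop := tL.const_mul_atTop h2α
  have tM : Tendsto (fun n : ℕ => Mn n α) atTop atTop := by
    unfold Mn; exact Real.tendsto_sqrt_atTop.comp tP
  have tM2 : Tendsto (fun n : ℕ => -(Mn n α ^ 2) / 2) atTop atBot := by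
    have h1 : Tendsto (fun n : ℕ => Mn n α ^ 2 / 2) atTop atTop :=
      ((tendsto_pow_atTop (by norm_num)).comp tM).atTop_div_const (by norm_num)
    refine (tendsto_neg_atTop_atBot.comp h1).congr fun n => ?_
    simp only [Function.comp]; ring
  have tq : Tendsto (fun n : ℕ => (δ / σ) ^ α * Real.exp (-(Mn n α ^ 2) / 2)) atTop (𝓝 0) := by
    have := (Real.tendsto_exp_atBot.comp tM2).const_mul ((δ / σ) ^ α)
    simpa using this
  have tKq : Tendsto (fun n : ℕ => KK α * ((δ / σ) ^ α * Real.exp (-(Mn n α ^ 2) / 2))) atTop (𝓝 0) := by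
    have := tq.const_mul (KK α)
    simpa using this
  have hg := gauss_pos Y0
  have ev := ((tLL.eventually_ge_atTop 1).and ((tL.eventually_ge_atTop 1).and ((eventually_ge_atTop 1).and
    ((tq.eventually_le_const (show (0:ℝ) < 1 by norm_num)).and
    ((tM.eventually_ge_atTop (Y0 + 2)).and
    ((tKq.eventually_le_const (show 0 < cc α / 4 by positivity)).and
     (tKq.eventually_le_const (show 0 < gauss Y0 / 2 by positivity))))))))
  obtain ⟨N, hN⟩ := eventually_atTop.1 ev
  refine ⟨2 * CT α (cc α) (cd α) (KK α) ((δ / σ) ^ α) Y0 * (δ / σ) ^ α * RR σ δ α ^ 2 * (2 - α) ^ (-((α + 1) / 2)) + 1,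
    by positivity, N, fun n hn => ?_⟩
  obtain ⟨h1, h2, h3, h4, h5, h6, h7⟩ := hN n hn
  refine single_n n σ δ α Y0 hσ hδ hα0 hα2 h1 h2 h3 h4 ⟨hA, rfl, by linarith, hY0, by linarith, ?_, h6, h7⟩
  rw [mul_one_div, div_le_iff₀ (by linarith), hY0d]
  have : cc α / 4 * (1 + 4 * KK α / cc α) = cc α / 4 + KK α := by field_simp
  linarith

end

/-- asymptotics of `∫ l_α² / f_α`. -/
theorem statement13 (σ δ α : ℝ) (hσ : 0 < σ) (hδ : 0 < δ) (hα : α ∈ Set.Ioo (0 : ℝ) 2) :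
    ∃ C > (0 : ℝ), ∃ N : ℕ, ∀ n ≥ N,
      |(∫ y : ℝ, lFun n α y (wn n σ δ α) ^ 2 / fFun α y (wn n σ δ α))
          - kappa0 σ δ α * (kappa1 σ δ α ^ 2 + 1 / α ^ 2) /
            ((n : ℝ) ^ (1 - α / 2) * Real.log n ^ (α / 2))| ≤
        C * (1 / ((n : ℝ) ^ (1 - α / 2) * Real.log n ^ (α / 2))) *
          (Real.log (Real.log n) ^ 3 / Real.log n ^ (min (1 / 4 : ℝ) α)) :=
  statement13' σ δ α hσ hδ hα

end LevyLAN
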